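/- arXiv:1912.10441 — 2 statements merged into one kernel-verified Lean document; each statement's English description precedes it below -/
import Mathlib

section
/- Let i be a nonnegative integer and let α, β be complex numbers. Assume that (β)_{m+n}, (−α/2+i/2)_n and (1+(i−α+β)/2)_n are nonzero for all nonnegative integers m, n, that no argument of Γ appearing on the right-hand side below is a nonpositive integer, and that the double series defining the Kampé de Fériet function converges absolutely. Then F^{2:0;2}_{1:0;2}[α, i−α : — ; 1−α/2+i/2, (i−α−β)/2 ; β : — ; −α/2+i/2, 1+(i−α+β)/2 ; 1/2, −1/2] = (2^{i−α} · Γ(α−i) · Γ(1+(β−α+i)/2)) / (Γ(α) · Γ(1+(β−3α+i)/2)) · Σ_{r=0}^{i} (−1)^r · C(i,r) · Γ((β−3α+i)/4+(r+1)/2) / Γ((β+α−3i)/4+(r+1)/2). -/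
open Complex

noncomputable section

/-- Pochhammer symbol `(a)_n = a (a+1) ⋯ (a+n-1)`. -/
def poch (a : ℂ) (n : ℕ) : ℂ := ∏ k ∈ Finset.range n, (a + k)

/-- `z` is not a nonpositive integer. -/
def notNonposInt (z : ℂ) : Prop := ∀ n : ℕ, z ≠ -(n : ℂ)

/-- Term of the Kampé de Fériet double series `F^{2:0;2}_{1:0;2}`. -/
def kdfTerm (h₁ h₂ b₁ b₂ β d₁ d₂ x y : ℂ) (p : ℕ × ℕ) : ℂ :=
  poch h₁ (p.1 + p.2) * poch h₂ (p.1 + p.2) * poch b₁ p.2 * poch b₂ p.2 /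
    (poch β (p.1 + p.2) * poch d₁ p.2 * poch d₂ p.2) * x ^ p.1 * y ^ p.2 /
    ((p.1.factorial : ℂ) * (p.2.factorial : ℂ))

open Filter Topology

lemma poch_zero (a : ℂ) : poch a 0 = 1 := by simp [poch]

lemma poch_succ (a : ℂ) (n : ℕ) : poch a (n + 1) = poch a n * (a + n) := by
  simp [poch, Finset.prod_range_succ]

lemma poch_succ_left (a : ℂ) (n : ℕ) : poch a (n + 1) = a * poch (a + 1) n := by
  simp only [poch, Finset.prod_range_succ', Nat.cast_add, Nat.cast_one, Nat.cast_zero, add_zero]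
  rw [mul_comm]
  congr 1
  exact Finset.prod_congr rfl fun k _ => by ring

lemma mul_poch_add_one (a : ℂ) (n : ℕ) : a * poch (a + 1) n = poch a n * (a + n) := by
  rw [← poch_succ_left, poch_succ]

lemma sum_alternating_choose_succ (f : ℕ → ℂ) (n : ℕ) :
    ∑ r ∈ Finset.range (n + 2), (-1 : ℂ) ^ r * ((n + 1).choose r : ℂ) * f r =
      ∑ r ∈ Finset.range (n + 1), (-1 : ℂ) ^ r * (n.choose r : ℂ) * f r -
        ∑ r ∈ Finset.range (n + 1), (-1 : ℂ) ^ r * (n.choose r : ℂ) * f (r + 1) := by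
  have h := Finset.sum_choose_succ_mul (fun r _ => (-1 : ℂ) ^ r * f r) n
  rw [← Finset.sum_sub_distrib]
  rw [← Finset.sum_add_distrib] at h
  convert h using 1
  · exact Finset.sum_congr rfl fun r _ => by ring
  · exact Finset.sum_congr rfl fun r _ => by ring

/-- A terminating well-poised sum, by Pascal's rule. -/
lemma sum_wellPoised (N : ℕ) (e b : ℂ) (hd : ∀ n, poch (1 + 2 * e - b) n ≠ 0) :
    ∑ n ∈ Finset.range (N + 1), (-1 : ℂ) ^ n * (N.choose n : ℂ) *
        ((e + n) * poch b n / poch (1 + 2 * e - b) n) =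
      poch (2 * e - 2 * b) N * (2 * e + N) / (2 * poch (1 + 2 * e - b) N) := by
  induction N generalizing e b with
  | zero => simp [poch_zero]
  | succ N ih =>
    have hd1 : 1 + 2 * e - b ≠ 0 := by simpa [poch] using hd 1
    have hs : ∀ n, poch (1 + 2 * (e + 1) - (b + 1)) n = poch (1 + 2 * e - b) (n + 1) / (1 + 2 * e - b) := by
      intro n
      rw [poch_succ_left, mul_div_cancel_left₀ _ hd1]
      congr 1
      ring
    have hsh : ∀ n, poch (1 + 2 * (e + 1) - (b + 1)) n ≠ 0 := fun n => by
      rw [hs]; exact div_ne_zero (hd _) hd1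
    rw [sum_alternating_choose_succ, ih e b hd]
    have key := ih (e + 1) (b + 1) hsh
    have hsum : ∑ r ∈ Finset.range (N + 1), (-1 : ℂ) ^ r * (N.choose r : ℂ) *
          ((e + (r + 1 : ℕ)) * poch b (r + 1) / poch (1 + 2 * e - b) (r + 1)) =
        b / (1 + 2 * e - b) * ∑ r ∈ Finset.range (N + 1), (-1 : ℂ) ^ r * (N.choose r : ℂ) *
          ((e + 1 + r) * poch (b + 1) r / poch (1 + 2 * (e + 1) - (b + 1)) r) := by
      rw [Finset.mul_sum]
      refine Finset.sum_congr rfl fun r _ => ?_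
      rw [hs, poch_succ_left b]
      have := hd (r + 1)
      push_cast
      generalize 1 + 2 * e - b = D at hd1 this ⊢
      field_simp
      ring
    rw [hsum, key, hs, poch_succ (2 * e - 2 * b), show 2 * (e + 1) - 2 * (b + 1) = 2 * e - 2 * b by ring]
    have h0 := hd N
    have h1 := hd (N + 1)
    rw [poch_succ] at h1 ⊢
    have h2 := right_ne_zero_of_mul h1
    push_cast
    field_simp
    ring

/-- Term of the regularised Gauss series at `1/2`. -/
def gaussTerm (a b c : ℂ) (n : ℕ) : ℂ :=
  poch a n * poch b n * (Gamma (c + n))⁻¹ / (n.factorial * 2 ^ n)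

lemma inv_Gamma (s : ℂ) : (Gamma s)⁻¹ = s * (Gamma (s + 1))⁻¹ := by
  exact one_div_Gamma_eq_self_mul_one_div_Gamma_add_one s

lemma gaussTerm_succ (a b c : ℂ) (n : ℕ) :
    gaussTerm a b c (n + 1) * (2 * (c + n) * (n + 1)) = (a + n) * (b + n) * gaussTerm a b c n := by
  unfold gaussTerm
  rw [inv_Gamma (c + n), poch_succ, poch_succ, Nat.factorial_succ]
  have := n.factorial_ne_zero
  have h' : (n + 1 : ℂ) ≠ 0 := by exact_mod_cast n.succ_ne_zero
  push_cast
  rw [add_assoc c]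
  field_simp
  ring

lemma tendsto_add_div (a : ℂ) :
    Tendsto (fun n : ℕ => ‖a + n‖ / (n + 1)) atTop (𝓝 1) := by
  have h := tendsto_add_mul_div_add_mul_atTop_nhds a (1 : ℂ) 1 (one_ne_zero)
  have := h.norm
  simp only [one_mul, div_one, norm_one] at this
  refine this.congr fun n => ?_
  rw [norm_div]
  congr 1
  rw [add_comm]
  exact_mod_cast Complex.norm_natCast (n + 1)

lemma summable_norm_gaussTerm (a b c : ℂ) : Summable fun n => ‖gaussTerm a b c n‖ := by
  refine summable_of_ratio_norm_eventually_le (r := 3 / 4) (by norm_num) ?_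
  have hl := ((tendsto_add_div a).mul (tendsto_add_div b))
  have hr := (tendsto_add_div c)
  have h1 := hl.eventually_lt_const (u := (5 / 4 : ℝ)) (by norm_num)
  have h2 := hr.eventually_const_lt (u := (5 / 6 : ℝ)) (by norm_num)
  filter_upwards [h1, h2] with n h1 h2
  have hn : (0 : ℝ) < n + 1 := by positivity
  rw [← mul_div_mul_comm, div_lt_iff₀ (by positivity)] at h1
  rw [lt_div_iff₀ hn] at h2
  have hc := congrArg norm (gaussTerm_succ a b c n)
  have hn' : ‖(n + 1 : ℂ)‖ = n + 1 := by exact_mod_cast Complex.norm_natCast (n + 1)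
  simp only [norm_mul, hn', Complex.norm_ofNat] at hc
  simp only [norm_norm]
  have hpos : 0 < 2 * ‖c + n‖ * (n + 1) := by nlinarith
  refine le_of_mul_le_mul_right ?_ hpos
  rw [hc]
  have : ‖a + n‖ * ‖b + n‖ ≤ 3 / 4 * (2 * ‖c + n‖ * (n + 1)) := by nlinarith
  nlinarith [norm_nonneg (gaussTerm a b c n)]

lemma summable_gaussTerm (a b c : ℂ) : Summable (gaussTerm a b c) :=
  (summable_norm_gaussTerm a b c).of_norm

/-- The regularised Gauss series `₂F₁(a, b; c; 1/2) / Γ(c)`. -/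
def gaussHalf (a b c : ℂ) : ℂ := ∑' n, gaussTerm a b c n

lemma gaussHalf_contiguous (a b c : ℂ) :
    a * gaussHalf (a + 1) b (c + 1) = gaussHalf a b c - (c - a) * gaussHalf a b (c + 1) := by
  unfold gaussHalf
  rw [← tsum_mul_left, ← tsum_mul_left,
    ← (summable_gaussTerm a b c).tsum_sub ((summable_gaussTerm a b (c + 1)).mul_left _)]
  refine tsum_congr fun n => ?_
  unfold gaussTerm
  rw [inv_Gamma (c + n), add_right_comm c n 1]
  linear_combination (poch b n * (Gamma (c + 1 + n))⁻¹ / (n.factorial * 2 ^ n)) * mul_poch_add_one a n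

lemma gaussHalf_add_two (a c : ℂ) :
    gaussHalf a (1 - a) c = (c + a) * (c - a + 1) * gaussHalf a (1 - a) (c + 2) := by
  set G : ℕ → ℂ := fun n => -2 * n * gaussTerm a (1 - a) (c + 1) n with hG
  have hu : ∀ n : ℕ, gaussTerm a (1 - a) (c + 1) n = (c + 1 + n) * gaussTerm a (1 - a) (c + 2) n := by
    intro n
    unfold gaussTerm
    rw [inv_Gamma (c + 1 + n), show c + 1 + n + 1 = c + 2 + n by ring]
    ring
  have ht : ∀ n : ℕ, gaussTerm a (1 - a) c n = (c + n) * gaussTerm a (1 - a) (c + 1) n := by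
    intro n
    unfold gaussTerm
    rw [inv_Gamma (c + n), show c + n + 1 = c + 1 + n by ring]
    ring
  have hG1 : ∀ n : ℕ, G (n + 1) = -((a + n) * (1 - a + n)) * gaussTerm a (1 - a) (c + 2) n := by
    intro n
    have h := gaussTerm_succ a (1 - a) (c + 2) n
    simp only [hG, hu]
    push_cast
    linear_combination -h
  have hdiff : ∀ n : ℕ, gaussTerm a (1 - a) c n - (c + a) * (c - a + 1) * gaussTerm a (1 - a) (c + 2) n =
      G (n + 1) - G n := by
    intro n
    rw [hG1, ht]
    simp only [hG, hu]
    ring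
  have s1 := summable_gaussTerm a (1 - a) c
  have s2 := (summable_gaussTerm a (1 - a) (c + 2)).mul_left ((c + a) * (c - a + 1))
  have hGs : Summable fun n => G (n + 1) := by
    have := (summable_gaussTerm (a + 1) (1 - a + 1) (c + 2)).mul_left (-(a * (1 - a)))
    refine this.congr fun n => ?_
    rw [hG1]
    unfold gaussTerm
    linear_combination (-((Gamma (c + 2 + n))⁻¹ / (n.factorial * 2 ^ n))) *
      (mul_poch_add_one a n * ((1 - a) * poch (1 - a + 1) n) +
        mul_poch_add_one (1 - a) n * (poch a n * (a + n)))
  have hGs' : Summable G := (summable_nat_add_iff 1).1 hGs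
  have h0 : ∑' n, (G (n + 1) - G n) = 0 := by
    rw [hGs.tsum_sub hGs', hGs'.tsum_eq_zero_add]
    simp [hG]
  unfold gaussHalf
  rw [← tsum_mul_left, ← sub_eq_zero, ← s1.tsum_sub s2, ← h0]
  exact tsum_congr hdiff

lemma gaussHalf_add_two_mul (a c : ℂ) (N : ℕ) :
    gaussHalf a (1 - a) c =
      4 ^ N * poch ((c + a) / 2) N * poch ((c - a + 1) / 2) N * gaussHalf a (1 - a) (c + 2 * N) := by
  induction N with
  | zero => simp [poch_zero]
  | succ N ih =>
    rw [ih, gaussHalf_add_two a (c + 2 * N), poch_succ, poch_succ, pow_succ,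
      show c + 2 * ((N + 1 : ℕ) : ℂ) = c + 2 * N + 2 by push_cast; ring]
    ring

lemma inv_Gamma_eq_poch (c : ℂ) (n : ℕ) : (Gamma c)⁻¹ = poch c n * (Gamma (c + n))⁻¹ := by
  induction n with
  | zero => simp [poch_zero]
  | succ n ih =>
    rw [ih, poch_succ, inv_Gamma (c + n)]
    push_cast
    rw [add_assoc c]
    ring

lemma poch_two_mul (c : ℂ) (N : ℕ) :
    poch c (2 * N) = 4 ^ N * poch (c / 2) N * poch ((c + 1) / 2) N := by
  induction N with
  | zero => simp [poch_zero]
  | succ N ih =>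
    rw [show 2 * (N + 1) = 2 * N + 1 + 1 by ring, poch_succ, poch_succ, ih, poch_succ, poch_succ, pow_succ]
    push_cast
    ring

lemma factorial_le_norm_poch {z : ℂ} (hz : 1 ≤ z.re) (n : ℕ) : (n.factorial : ℝ) ≤ ‖poch z n‖ := by
  induction n with
  | zero => simp [poch_zero]
  | succ n ih =>
    rw [poch_succ, norm_mul, Nat.factorial_succ, Nat.cast_mul, mul_comm]
    have : ((n + 1 : ℕ) : ℝ) ≤ ‖z + n‖ := by
      refine le_trans ?_ (Complex.re_le_norm _)
      simp only [add_re, natCast_re]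
      push_cast
      linarith
    gcongr

lemma poch_ne_zero_of_one_le_re {z : ℂ} (hz : 1 ≤ z.re) (n : ℕ) : poch z n ≠ 0 := by
  have := factorial_le_norm_poch hz n
  have h2 : (0 : ℝ) < n.factorial := by positivity
  exact norm_pos_iff.1 (h2.trans_le this)

lemma Gamma_mul_gaussTerm (a b : ℂ) {z : ℂ} (hz : Gamma z ≠ 0) (n : ℕ) :
    Gamma z * gaussTerm a b z n = poch a n * poch b n * (poch z n)⁻¹ / (n.factorial * 2 ^ n) := by
  have h : Gamma z * (Gamma (z + n))⁻¹ = (poch z n)⁻¹ := by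
    have := inv_Gamma_eq_poch z n
    refine eq_inv_of_mul_eq_one_left ?_
    rw [mul_assoc, mul_comm _ (poch z n), ← this, mul_inv_cancel₀ hz]
  rw [← h, gaussTerm]
  ring

lemma tendsto_Gamma_mul_gaussHalf (a b : ℂ) {c : ℂ} (hc : 1 ≤ c.re) :
    Tendsto (fun N : ℕ => Gamma (c + 2 * N) * gaussHalf a b (c + 2 * N)) atTop (𝓝 1) := by
  have hre : ∀ N : ℕ, (N : ℝ) + 1 ≤ (c + 2 * N).re := by
    intro N
    simp only [add_re, mul_re, re_ofNat, natCast_re, im_ofNat, natCast_im]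
    have : (0 : ℝ) ≤ N := N.cast_nonneg
    linarith
  have hre1 : ∀ N : ℕ, 1 ≤ (c + 2 * N).re := fun N => by
    have : (0 : ℝ) ≤ N := N.cast_nonneg
    linarith [hre N]
  have hterm : ∀ N n : ℕ, Gamma (c + 2 * N) * gaussTerm a b (c + 2 * N) n =
      poch a n * poch b n * (poch (c + 2 * N) n)⁻¹ / (n.factorial * 2 ^ n) := fun N n =>
    Gamma_mul_gaussTerm a b (Gamma_ne_zero_of_re_pos (by linarith [hre1 N])) n
  have hlim : (1 : ℂ) = ∑' n : ℕ, if n = 0 then 1 else 0 := by rw [tsum_ite_eq]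
  simp only [gaussHalf, ← tsum_mul_left]
  rw [hlim]
  refine tendsto_tsum_of_dominated_convergence (summable_norm_gaussTerm a b 1) ?_ ?_
  · rintro (_ | m)
    · simp [hterm, poch_zero]
    · simp only [hterm, Nat.add_eq_zero_iff, one_ne_zero, and_false, if_false]
      have h0 : Tendsto (fun N : ℕ => (poch (c + 2 * N) (m + 1))⁻¹) atTop (𝓝 0) := by
        refine squeeze_zero_norm (fun N => ?_) tendsto_one_div_add_atTop_nhds_zero_nat
        rw [norm_inv, one_div]
        have h1 : (N : ℝ) + 1 ≤ ‖c + 2 * N‖ := (hre N).trans (Complex.re_le_norm _)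
        have h2 := factorial_le_norm_poch (z := c + 2 * N + 1)
          (by rw [add_re, one_re]; linarith [hre1 N]) m
        have h3 : (1 : ℝ) ≤ m.factorial := by exact_mod_cast m.factorial_pos
        refine inv_anti₀ (by positivity) ?_
        rw [poch_succ_left, norm_mul]
        nlinarith [(N.cast_nonneg : (0 : ℝ) ≤ N)]
      simpa using (h0.const_mul (poch a (m + 1) * poch b (m + 1))).div_const
        (((m + 1).factorial : ℂ) * 2 ^ (m + 1))
  · refine Eventually.of_forall fun N n => ?_
    rw [hterm, gaussTerm, add_comm (1 : ℂ), Gamma_nat_eq_factorial]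
    simp only [norm_div, norm_mul, norm_inv, Complex.norm_natCast]
    have := factorial_le_norm_poch (hre1 N) n
    gcongr

lemma poch_succ_eq_GammaSeq (s : ℂ) {N : ℕ} (hN : N ≠ 0) :
    poch s (N + 1) = (N : ℂ) ^ s * N.factorial * (GammaSeq s N)⁻¹ := by
  have h1 : (N : ℂ) ^ s ≠ 0 := by
    rw [Ne, cpow_eq_zero_iff]
    exact fun h => hN (by exact_mod_cast h.1)
  have h2 : (N.factorial : ℂ) ≠ 0 := by exact_mod_cast N.factorial_ne_zero
  rw [GammaSeq, inv_div, mul_div_cancel₀ _ (mul_ne_zero h1 h2)]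
  rfl

lemma gaussHalf_one_sub_of_re (a c : ℂ) (hc : 1 ≤ c.re) (hx : 0 < ((c + a) / 2).re)
    (hy : 0 < ((c - a + 1) / 2).re) :
    gaussHalf a (1 - a) c =
      2 ^ (1 - c) * (√Real.pi : ℝ) * ((Gamma ((c + a) / 2))⁻¹ * (Gamma ((c - a + 1) / 2))⁻¹) := by
  have hGc : Gamma c ≠ 0 := Gamma_ne_zero_of_re_pos (by linarith)
  have hL := (tendsto_Gamma_mul_gaussHalf a (1 - a) hc).comp (tendsto_add_atTop_nat 1)
  have hR := (((GammaSeq_tendsto_Gamma (c / 2)).mul (GammaSeq_tendsto_Gamma ((c + 1) / 2))).mul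
    (((GammaSeq_tendsto_Gamma ((c + a) / 2)).inv₀ (Gamma_ne_zero_of_re_pos hx)).mul
    ((GammaSeq_tendsto_Gamma ((c - a + 1) / 2)).inv₀ (Gamma_ne_zero_of_re_pos hy)))).mul_const
      (Gamma c)⁻¹
  have hfin := hR.mul hL
  have hdup := Gamma_mul_Gamma_add_half (c / 2)
  rw [show c / 2 + 1 / 2 = (c + 1) / 2 by ring, show 2 * (c / 2) = c by ring] at hdup
  rw [hdup, mul_one] at hfin
  have hconst : ∀ᶠ N : ℕ in atTop, gaussHalf a (1 - a) c =
      GammaSeq (c / 2) N * GammaSeq ((c + 1) / 2) N *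
        ((GammaSeq ((c + a) / 2) N)⁻¹ * (GammaSeq ((c - a + 1) / 2) N)⁻¹) * (Gamma c)⁻¹ *
        (Gamma (c + 2 * (N + 1 : ℕ)) * gaussHalf a (1 - a) (c + 2 * (N + 1 : ℕ))) := by
    filter_upwards [eventually_ne_atTop 0] with N hN
    have hN' : (N : ℂ) ≠ 0 := by exact_mod_cast hN
    have hpow : (N : ℂ) ^ ((c + a) / 2) * (N : ℂ) ^ ((c - a + 1) / 2) =
        (N : ℂ) ^ (c / 2) * (N : ℂ) ^ ((c + 1) / 2) := by
      rw [← cpow_add _ _ hN', ← cpow_add _ _ hN']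
      congr 1
      ring
    have hp := inv_Gamma_eq_poch c (2 * (N + 1))
    have hpne := poch_ne_zero_of_one_le_re hc (2 * (N + 1))
    have hg : Gamma (c + 2 * (N + 1 : ℕ)) ≠ 0 := by
      intro h0
      push_cast at hp h0
      rw [h0] at hp
      simp at hp
      exact hGc hp
    rw [poch_two_mul] at hp hpne
    rw [gaussHalf_add_two_mul a c (N + 1), hp]
    rw [poch_succ_eq_GammaSeq _ hN, poch_succ_eq_GammaSeq _ hN] at hp hpne ⊢
    have hA : GammaSeq (c / 2) N ≠ 0 := fun h => hpne (by simp [h])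
    have hB : GammaSeq ((c + 1) / 2) N ≠ 0 := fun h => hpne (by simp [h])
    rw [poch_succ_eq_GammaSeq _ hN, poch_succ_eq_GammaSeq _ hN]
    push_cast at hg ⊢
    field_simp
    linear_combination (N.factorial ^ 2 * gaussHalf a (1 - a) (c + 2 * (N + 1)) *
      (GammaSeq ((c + a) / 2) N)⁻¹ * (GammaSeq ((c - a + 1) / 2) N)⁻¹) * hpow
  have := tendsto_nhds_unique (tendsto_const_nhds.congr' hconst) hfin
  rw [this]
  field_simp

/-- Bailey's evaluation, in regularised form valid for all parameters. -/
lemma gaussHalf_one_sub (a c : ℂ) :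
    gaussHalf a (1 - a) c =
      2 ^ (1 - c) * (√Real.pi : ℝ) * ((Gamma ((c + a) / 2))⁻¹ * (Gamma ((c - a + 1) / 2))⁻¹) := by
  obtain ⟨N, hN⟩ := exists_nat_gt (1 + |c.re| + |a.re|)
  rw [gaussHalf_add_two_mul a c N, gaussHalf_one_sub_of_re,
    inv_Gamma_eq_poch ((c + a) / 2) N, inv_Gamma_eq_poch ((c - a + 1) / 2) N,
    show (c + 2 * N + a) / 2 = (c + a) / 2 + N by ring,
    show (c + 2 * N - a + 1) / 2 = (c - a + 1) / 2 + N by ring]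
  · have : (2 : ℂ) ^ (1 - c) = 4 ^ N * 2 ^ (1 - (c + 2 * N)) := by
      rw [show (4 : ℂ) ^ N = 2 ^ ((2 * N : ℕ) : ℂ) by rw [cpow_natCast, pow_mul]; norm_num,
        ← cpow_add _ _ two_ne_zero]
      congr 1
      push_cast
      ring
    rw [this]
    ring
  all_goals
    simp only [add_re, sub_re, mul_re, re_ofNat, natCast_re, im_ofNat, natCast_im, div_ofNat_re, one_re]
    have := abs_le.1 (le_refl |c.re|)
    have := abs_le.1 (le_refl |a.re|)
    have := abs_nonneg c.re
    have := abs_nonneg a.re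
    linarith

/-- `₂F₁(q + i, 1 - q; p + q + i; 1/2)` as a finite sum of quotients of Gamma values. -/
lemma gaussHalf_eq_sum (i : ℕ) (p q : ℂ) (hq : notNonposInt q) (hp : notNonposInt p) :
    gaussHalf (q + i) (1 - q) (p + q + i) =
      2 ^ (-q) * Gamma q / (Gamma (q + i) * Gamma p) *
        ∑ r ∈ Finset.range (i + 1), (-1 : ℂ) ^ r * (i.choose r : ℂ) *
          (Gamma ((p + r) / 2) / Gamma ((p + r) / 2 + q)) := by
  have hΓq := Gamma_ne_zero hq
  induction i generalizing p with
  | zero =>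
    have hΓp := Gamma_ne_zero hp
    have hdup := Gamma_mul_Gamma_add_half (p / 2)
    rw [show 2 * (p / 2) = p by ring] at hdup
    have hg : Gamma (p / 2 + 1 / 2) ≠ 0 := Gamma_ne_zero fun m h => hp (2 * m + 1) (by
      push_cast
      linear_combination 2 * h)
    simp only [Nat.cast_zero, add_zero, zero_add, Finset.sum_range_one, pow_zero, Nat.choose_self,
      Nat.cast_one, one_mul]
    rw [gaussHalf_one_sub, show (p + q + q) / 2 = p / 2 + q by ring,
      show (p + q - q + 1) / 2 = p / 2 + 1 / 2 by ring,
      show 1 - (p + q) = (1 - p) + -q by ring, cpow_add _ _ two_ne_zero,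
      eq_div_of_mul_eq hg hdup]
    generalize Gamma (p / 2 + q) = X
    generalize Gamma (p / 2 + 1 / 2) = Y
    field_simp
  | succ i ih =>
    have hp1 : notNonposInt (p + 1) := fun n h => hp (n + 1) (by push_cast; linear_combination h)
    have hqi : q + i ≠ 0 := fun h => hq i (by linear_combination h)
    have hp0 : p ≠ 0 := fun h => hp 0 (by simpa using h)
    have hΓp := Gamma_ne_zero hp
    have hΓqi : Gamma (q + i) ≠ 0 := by
      refine Gamma_ne_zero fun m h => hq (m + i) ?_
      push_cast
      linear_combination h
    have hc := gaussHalf_contiguous (q + i) (1 - q) (p + q + i)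
    have h1 := ih p hp
    have h2 := ih (p + 1) hp1
    rw [show p + 1 + q + i = p + q + i + 1 by ring] at h2
    rw [h1, h2, Gamma_add_one p hp0] at hc
    have hsum := sum_alternating_choose_succ
      (fun r => Gamma ((p + r) / 2) / Gamma ((p + r) / 2 + q)) i
    push_cast at hsum ⊢
    simp only [show ∀ r : ℕ, p + ((r : ℂ) + 1) = p + 1 + r from fun r => by ring] at hsum
    rw [hsum, ← add_assoc, ← add_assoc, Gamma_add_one _ hqi]
    refine mul_left_cancel₀ hqi (hc.trans ?_)
    field_simp
    ring

lemma sum_antidiagonal_kdfTerm (a A β d : ℂ) (N : ℕ) (hA : A ≠ 0) (hd : d = 1 + (A + β) / 2)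
    (hβ : poch β N ≠ 0) (hA2 : ∀ n, poch (A / 2) n ≠ 0) (hdn : ∀ n, poch d n ≠ 0) :
    ∑ x ∈ Finset.HasAntidiagonal.antidiagonal N,
        kdfTerm a A (1 + A / 2) ((A - β) / 2) β (A / 2) d (1 / 2) (-1 / 2) x =
      poch a N * poch (1 + A) N / (poch d N * (N.factorial * 2 ^ N)) := by
  have hd' : 1 + 2 * (A / 2) - (A - β) / 2 = d := by rw [hd]; ring
  have key := sum_wellPoised N (A / 2) ((A - β) / 2) (by rwa [hd'])
  rw [hd', show 2 * (A / 2) - 2 * ((A - β) / 2) = β by ring, show 2 * (A / 2) = A by ring] at key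
  have hN : (N.factorial : ℂ) ≠ 0 := by exact_mod_cast N.factorial_ne_zero
  have hterm : ∀ n ∈ Finset.range (N + 1),
      kdfTerm a A (1 + A / 2) ((A - β) / 2) β (A / 2) d (1 / 2) (-1 / 2) (N - n, n) =
        poch a N * poch A N / (poch β N * (A / 2) * N.factorial * 2 ^ N) *
          ((-1 : ℂ) ^ n * (N.choose n : ℂ) *
            ((A / 2 + n) * poch ((A - β) / 2) n / poch d n)) := by
    intro n hn
    have hle : n ≤ N := Nat.lt_succ_iff.1 (Finset.mem_range.1 hn)
    have h1 := mul_poch_add_one (A / 2) n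
    have h2 : (1 / 2 : ℂ) ^ (N - n) * (-1 / 2) ^ n = (-1) ^ n / 2 ^ N := by
      rw [div_pow, div_pow, one_pow, div_mul_div_comm, one_mul, ← pow_add, Nat.sub_add_cancel hle]
    rw [kdfTerm, Nat.cast_choose ℂ hle]
    simp only [Nat.sub_add_cancel hle]
    rw [mul_assoc (_ / _) ((1 / 2 : ℂ) ^ (N - n)), h2, add_comm (1 : ℂ),
      eq_div_of_mul_eq (div_ne_zero hA two_ne_zero) ((mul_comm _ _).trans h1)]
    have h3 := hA2 n
    have h4 : (n.factorial : ℂ) ≠ 0 := by exact_mod_cast n.factorial_ne_zero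
    have h5 : ((N - n).factorial : ℂ) ≠ 0 := by exact_mod_cast (N - n).factorial_ne_zero
    have h6 := hdn n
    generalize poch (A / 2) n = P at h3 ⊢
    field_simp
  rw [Finset.Nat.sum_antidiagonal_eq_sum_range_succ_mk,
    ← Finset.sum_range_reflect]
  have hrefl : ∀ n ∈ Finset.range (N + 1),
      kdfTerm a A (1 + A / 2) ((A - β) / 2) β (A / 2) d (1 / 2) (-1 / 2) (N + 1 - 1 - n, N - (N + 1 - 1 - n)) =
        kdfTerm a A (1 + A / 2) ((A - β) / 2) β (A / 2) d (1 / 2) (-1 / 2) (N - n, n) := by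
    intro n hn
    have hle : n ≤ N := Nat.lt_succ_iff.1 (Finset.mem_range.1 hn)
    rw [Nat.add_sub_cancel, Nat.sub_sub_self hle]
  rw [Finset.sum_congr rfl hrefl, Finset.sum_congr rfl hterm, ← Finset.mul_sum, key,
    add_comm 1 A, eq_div_of_mul_eq hA ((mul_comm _ _).trans (mul_poch_add_one A N))]
  have h6 := hdn N
  field_simp

lemma tsum_eq_tsum_sum_antidiagonal {f : ℕ × ℕ → ℂ} (hf : Summable f) :
    ∑' p, f p = ∑' N, ∑ x ∈ Finset.HasAntidiagonal.antidiagonal N, f x := by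
  rw [← Finset.HasAntidiagonal.sigmaAntidiagonalEquivProd.tsum_eq]
  have hs := Finset.HasAntidiagonal.sigmaAntidiagonalEquivProd.summable_iff.2 hf
  refine (hs.tsum_sigma' fun N => (hasSum_fintype _).summable).trans ?_
  refine tsum_congr fun N => ?_
  rw [tsum_fintype]
  exact Finset.sum_coe_sort (Finset.HasAntidiagonal.antidiagonal N) f

theorem stmt_17 (i : ℕ) (α β : ℂ)
    (hβ : ∀ m n : ℕ, poch β (m + n) ≠ 0)
    (hd1 : ∀ n : ℕ, poch (-α / 2 + (i : ℂ) / 2) n ≠ 0)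
    (hd2 : ∀ n : ℕ, poch (1 + ((i : ℂ) - α + β) / 2) n ≠ 0)
    (hΓ1 : notNonposInt (α - (i : ℂ)))
    (hΓ2 : notNonposInt (1 + (β - α + (i : ℂ)) / 2))
    (hΓ3 : notNonposInt (α))
    (hΓ4 : notNonposInt (1 + (β - 3 * α + (i : ℂ)) / 2))
    (hΓs : ∀ r : ℕ, r ≤ i →
      notNonposInt ((β - 3 * α + (i : ℂ)) / 4 + ((r : ℂ) + 1) / 2) ∧ notNonposInt ((β + α - 3 * (i : ℂ)) / 4 + ((r : ℂ) + 1) / 2))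
    (hsum : Summable fun p : ℕ × ℕ => ‖kdfTerm α ((i : ℂ) - α) (1 - α / 2 + (i : ℂ) / 2) (((i : ℂ) - α - β) / 2) β (-α / 2 + (i : ℂ) / 2) (1 + ((i : ℂ) - α + β) / 2) (1/2) (-1/2) p‖) :
    (∑' p : ℕ × ℕ, kdfTerm α ((i : ℂ) - α) (1 - α / 2 + (i : ℂ) / 2) (((i : ℂ) - α - β) / 2) β (-α / 2 + (i : ℂ) / 2) (1 + ((i : ℂ) - α + β) / 2) (1/2) (-1/2) p) =
      (2 : ℂ) ^ ((i : ℂ) - α) * Gamma (α - (i : ℂ)) * Gamma (1 + (β - α + (i : ℂ)) / 2) /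
        (Gamma α * Gamma (1 + (β - 3 * α + (i : ℂ)) / 2)) *
      ∑ r ∈ Finset.range (i + 1), (-1 : ℂ) ^ r * (i.choose r : ℂ) *
        Gamma ((β - 3 * α + (i : ℂ)) / 4 + ((r : ℂ) + 1) / 2) /
        Gamma ((β + α - 3 * (i : ℂ)) / 4 + ((r : ℂ) + 1) / 2) := by
  set A : ℂ := (i : ℂ) - α with hA
  set d : ℂ := 1 + (A + β) / 2 with hd
  have hA2 : ∀ n, poch (A / 2) n ≠ 0 := fun n => by
    rw [show A / 2 = -α / 2 + (i : ℂ) / 2 by rw [hA]; ring]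
    exact hd1 n
  have hA0 : A ≠ 0 := fun h => by simpa [poch, h] using hA2 1
  have hΓd : notNonposInt d := by
    rwa [show d = 1 + (β - α + (i : ℂ)) / 2 by rw [hd, hA]; ring]
  have hdΓ := Gamma_ne_zero hΓd
  have e1 : 1 - α / 2 + (i : ℂ) / 2 = 1 + A / 2 := by rw [hA]; ring
  have e2 : -α / 2 + (i : ℂ) / 2 = A / 2 := by rw [hA]; ring
  rw [e1, e2] at hsum ⊢
  rw [tsum_eq_tsum_sum_antidiagonal hsum.of_norm]
  have hsumN : ∀ N, ∑ x ∈ Finset.HasAntidiagonal.antidiagonal N,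
        kdfTerm α A (1 + A / 2) ((A - β) / 2) β (A / 2) d (1 / 2) (-1 / 2) x =
      Gamma d * gaussTerm α (1 + A) d N := fun N => by
    rw [sum_antidiagonal_kdfTerm α A β d N hA0 hd (by simpa using hβ N 0) hA2 hd2,
      Gamma_mul_gaussTerm _ _ hdΓ]
    have := hd2 N
    field_simp
  have hmain := gaussHalf_eq_sum i (1 + (β - 3 * α + (i : ℂ)) / 2) (α - i) hΓ1 hΓ4
  rw [show α - (i : ℂ) + i = α by ring, show 1 - (α - (i : ℂ)) = 1 + A by rw [hA]; ring,
    show 1 + (β - 3 * α + (i : ℂ)) / 2 + (α - i) + i = d by rw [hd, hA]; ring,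
    show -(α - (i : ℂ)) = A by rw [hA]; ring] at hmain
  rw [tsum_congr hsumN, tsum_mul_left, ← gaussHalf, hmain,
    show 1 + (β - α + (i : ℂ)) / 2 = d by rw [hd, hA]; ring, ← mul_assoc]
  congr 1
  · ring
  · refine Finset.sum_congr rfl fun r _ => ?_
    rw [← mul_div_assoc,
      show (1 + (β - 3 * α + (i : ℂ)) / 2 + r) / 2 + (α - i) =
        (β + α - 3 * (i : ℂ)) / 4 + ((r : ℂ) + 1) / 2 by ring,
      show (1 + (β - 3 * α + (i : ℂ)) / 2 + r) / 2 =
        (β - 3 * α + (i : ℂ)) / 4 + ((r : ℂ) + 1) / 2 by ring]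
end
end

section
/- Let i be a nonnegative integer, let β, γ be complex numbers, and set α := β/2+3γ/2+1−i. Assume that (β)_{m+n}, (γ/2)_n and (1+(γ+β)/2)_n are nonzero for all nonnegative integers m, n, that no argument of Γ appearing on the right-hand side below is a nonpositive integer, and that the double series defining the Kampé de Fériet function converges absolutely. Then F^{2:0;2}_{1:0;2}[α, γ : — ; 1+γ/2, (γ−β)/2 ; β : — ; γ/2, 1+(γ+β)/2 ; −1, 1] = (2^{(β−γ)/2−α−1} · Γ(1+(β+γ)/2) · Γ(γ−i+1)) / (Γ((β−γ)/2) · Γ(γ+1)) · Σ_{r=0}^{i} (−1)^r · C(i,r) · Γ((β−γ)/4+r/2) / Γ((β+3γ)/4+1−i+r/2). -/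
open Complex

noncomputable section

open Filter Topology

lemma poch_sub_one_succ (b : ℂ) (n : ℕ) : poch (b - 1) (n + 1) = (b - 1) * poch b n := by
  rw [poch_succ_left, sub_add_cancel]

lemma Gamma_inv_shift (z : ℂ) (n : ℕ) :
    (Gamma (z + n))⁻¹ = (z + n) * (Gamma (z + (n + 1 : ℕ)))⁻¹ := by
  rw [one_div_Gamma_eq_self_mul_one_div_Gamma_add_one]
  push_cast
  ring_nf

lemma Gamma_add_nat (z : ℂ) (hz : notNonposInt z) (n : ℕ) :
    Gamma (z + n) = poch z n * Gamma z := by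
  induction n with
  | zero => simp [poch_zero]
  | succ n ih =>
    have h : z + n ≠ 0 := fun h => hz n (eq_neg_of_add_eq_zero_left h)
    push_cast
    rw [← add_assoc, Gamma_add_one _ h, ih, poch_succ]
    ring

/-- Terms of the regularized series `₂F₁(a, b; c; -1) / Γ(c)`. -/
def hypTerm (a b c : ℂ) (n : ℕ) : ℂ :=
  (-1) ^ n * poch a n * poch b n * (Gamma (c + n))⁻¹ / (n.factorial : ℂ)

lemma hypTerm_zero (a b c : ℂ) : hypTerm a b c 0 = (Gamma c)⁻¹ := by
  simp [hypTerm, poch_zero]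

lemma tsum_eq_zero_of_telescoping {f g : ℕ → ℂ} (hf : Summable f) (h0 : f 0 = g 0)
    (hs : ∀ n, f (n + 1) = g (n + 1) - g n) (hg : Tendsto g atTop (𝓝 0)) : ∑' n, f n = 0 := by
  have h : ∀ n, ∑ k ∈ Finset.range (n + 1), f k = g n := by
    intro n
    induction n with
    | zero => simpa using h0
    | succ n ih => rw [Finset.sum_range_succ, ih, hs]; ring
  have h1 := (tendsto_add_atTop_iff_nat 1).2 hf.hasSum.tendsto_sum_nat
  simp only [h] at h1
  exact tendsto_nhds_unique h1 hg

lemma tendsto_norm_add_nat_atTop (z : ℂ) : Tendsto (fun n : ℕ => ‖z + n‖) atTop atTop := by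
  refine tendsto_atTop_mono (f := fun n : ℕ => -‖z‖ + n) (fun n => ?_)
    (tendsto_atTop_add_const_left _ _ tendsto_natCast_atTop_atTop)
  have := norm_sub_norm_le (n : ℂ) (-z)
  rw [norm_neg, sub_neg_eq_add, add_comm (n : ℂ) z, norm_natCast] at this
  linarith

lemma eventually_norm_add_le_two_mul (y z : ℂ) :
    ∀ᶠ n : ℕ in atTop, ‖y + n‖ ≤ 2 * ‖z + n‖ := by
  filter_upwards [(tendsto_norm_add_nat_atTop z).eventually_ge_atTop ‖y - z‖] with n hn
  calc ‖y + n‖ = ‖(y - z) + (z + n)‖ := by ring_nf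
    _ ≤ ‖y - z‖ + ‖z + n‖ := norm_add_le _ _
    _ ≤ 2 * ‖z + n‖ := by linarith

lemma norm_le_norm_add_of_nonneg {u w : ℂ} (h : 0 ≤ u.re * w.re + u.im * w.im) :
    ‖u‖ ≤ ‖u + w‖ := by
  rw [← sq_le_sq₀ (norm_nonneg _) (norm_nonneg _), ← normSq_eq_norm_sq, ← normSq_eq_norm_sq,
    normSq_apply, normSq_apply, add_re, add_im]
  nlinarith [mul_self_nonneg w.re, mul_self_nonneg w.im]

lemma eventually_norm_add_le {y z : ℂ} (h : y.re < z.re) :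
    ∀ᶠ n : ℕ in atTop, ‖y + n‖ ≤ ‖z + n‖ := by
  have h1 : 0 < (z - y).re := by simpa using h
  have h2 : Tendsto (fun n : ℕ => (y.re * (z - y).re + y.im * (z - y).im) + n * (z - y).re)
      atTop atTop :=
    tendsto_atTop_add_const_left _ _ (tendsto_natCast_atTop_atTop.atTop_mul_const h1)
  filter_upwards [h2.eventually_ge_atTop 0] with n hn
  have := norm_le_norm_add_of_nonneg (u := y + n) (w := z - y) (by
    simp only [add_re, natCast_re, add_im, natCast_im] at hn ⊢
    linarith)
  calc ‖y + n‖ ≤ ‖y + n + (z - y)‖ := this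
    _ = ‖z + n‖ := by ring_nf

lemma eventually_add_nat_ne_zero (z : ℂ) : ∀ᶠ n : ℕ in atTop, z + n ≠ 0 := by
  filter_upwards [(tendsto_norm_add_nat_atTop z).eventually_ge_atTop 1] with n hn h
  rw [h, norm_zero] at hn
  linarith

lemma exists_norm_le_of_eventually_le_succ {u : ℕ → ℂ}
    (h : ∀ᶠ n in atTop, ‖u (n + 1)‖ ≤ ‖u n‖) : ∃ C, ∀ n, ‖u n‖ ≤ C := by
  obtain ⟨N, hN⟩ := eventually_atTop.1 h
  refine ⟨∑ k ∈ Finset.range (N + 1), ‖u k‖, fun n => ?_⟩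
  have hle : ∀ k ≤ N, ‖u k‖ ≤ ∑ k ∈ Finset.range (N + 1), ‖u k‖ := fun k hk =>
    Finset.single_le_sum (f := fun k => ‖u k‖) (fun _ _ => norm_nonneg _)
      (Finset.mem_range.2 (Nat.lt_succ_of_le hk))
  rcases le_total n N with h' | h'
  · exact hle n h'
  · induction n, h' using Nat.le_induction with
    | base => exact hle N le_rfl
    | succ n hn ih => exact (hN n hn).trans ih

lemma exists_norm_poch_mul_Gamma_inv_le {y z : ℂ} (h : y.re < z.re) :
    ∃ C, ∀ n : ℕ, ‖poch y n * (Gamma (z + n))⁻¹‖ ≤ C := by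
  apply exists_norm_le_of_eventually_le_succ
  filter_upwards [eventually_norm_add_le h, eventually_add_nat_ne_zero z] with n hn hz
  rw [Gamma_inv_shift z n, poch_succ]
  simp only [norm_mul]
  have : ‖y + n‖ * (‖poch y n‖ * ‖(Gamma (z + (n + 1 : ℕ)))⁻¹‖) ≤
      ‖z + n‖ * (‖poch y n‖ * ‖(Gamma (z + (n + 1 : ℕ)))⁻¹‖) := by gcongr
  linarith

lemma exists_norm_poch_div_factorial_le {b : ℂ} (hb : b.re < -1) :
    ∃ C, ∀ n : ℕ, (n : ℝ) ^ 2 * ‖poch b n / (n.factorial : ℂ)‖ ≤ C := by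
  obtain ⟨C, hC⟩ := exists_norm_poch_mul_Gamma_inv_le (y := b) (z := -1) (by simpa using hb)
  have hC0 : 0 ≤ C := (norm_nonneg _).trans (hC 0)
  refine ⟨max (2 * C) ‖b‖, fun n => ?_⟩
  rcases n with _ | _ | n
  · simp [hC0]
  · simp [poch]
  · refine le_trans ?_ (le_max_left _ _)
    have h1 : (-1 : ℂ) + ((n + 1 + 1 : ℕ) : ℂ) = n + 1 := by push_cast; ring
    have h2 := hC (n + 1 + 1)
    rw [h1, Gamma_nat_eq_factorial] at h2
    have h3 : ‖poch b (n + 1 + 1) / ((n + 1 + 1).factorial : ℂ)‖ =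
        ‖poch b (n + 1 + 1) * ((n.factorial : ℂ))⁻¹‖ / (((n : ℝ) + 2) * (n + 1)) := by
      rw [Nat.factorial_succ, Nat.factorial_succ]
      simp only [norm_mul, norm_div, norm_inv, norm_natCast, Nat.cast_mul]
      push_cast
      field_simp
      ring
    rw [h3, mul_div_assoc', div_le_iff₀ (by positivity)]
    have hn : (0 : ℝ) ≤ n := n.cast_nonneg
    calc (((n + 1 + 1 : ℕ) : ℝ)) ^ 2 * ‖poch b (n + 1 + 1) * ((n.factorial : ℂ))⁻¹‖
        ≤ (((n + 1 + 1 : ℕ) : ℝ)) ^ 2 * C := by gcongr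
      _ ≤ 2 * C * ((n + 2) * (n + 1)) := by
        push_cast
        nlinarith [mul_nonneg hC0 hn, mul_nonneg (mul_nonneg hC0 hn) hn]

lemma summable_norm_poch_div_factorial {b : ℂ} (hb : b.re < -1) :
    Summable fun n : ℕ => ‖poch b n / (n.factorial : ℂ)‖ := by
  obtain ⟨C, hC⟩ := exists_norm_poch_div_factorial_le hb
  refine Summable.of_norm_bounded_eventually_nat
    ((Real.summable_one_div_nat_pow.2 (one_lt_two)).mul_left C) ?_
  filter_upwards [eventually_ge_atTop 1] with n hn
  have : (0 : ℝ) < n := by exact_mod_cast hn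
  rw [norm_norm, mul_one_div, le_div_iff₀ (by positivity), mul_comm]
  exact hC n

lemma ringChoose_neg (b : ℂ) (n : ℕ) :
    Ring.choose (-b) n = (-1) ^ n * poch b n / (n.factorial : ℂ) := by
  have h : (descPochhammer ℤ n).smeval (-b) = (-1) ^ n * poch b n := by
    induction n with
    | zero => simp [poch_zero]
    | succ n ih =>
      rw [descPochhammer_succ_right, Polynomial.smeval_mul, ih, poch_succ]
      simp [Polynomial.smeval_sub, Polynomial.smeval_natCast]
      ring
  rw [eq_div_iff (by exact_mod_cast n.factorial_ne_zero), ← h,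
    Ring.descPochhammer_eq_factorial_smul_choose, nsmul_eq_mul, mul_comm]

lemma hasSum_binomial {b x : ℂ} (hx : ‖x‖ < 1) :
    HasSum (fun n : ℕ => (-1) ^ n * poch b n / (n.factorial : ℂ) * x ^ n) ((1 + x) ^ (-b)) := by
  have := (one_add_cpow_hasFPowerSeriesOnBall_zero (a := -b)).hasSum (y := x)
    (by rw [← ENNReal.ofReal_one, Metric.eball_ofReal]; simpa using hx)
  simpa only [zero_add, binomialSeries_apply, List.ofFn_const, List.prod_replicate, smul_eq_mul,
    ringChoose_neg] using this

lemma tsum_binomial_at_one {b : ℂ} (hb : b.re < -1) :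
    ∑' n : ℕ, (-1) ^ n * poch b n / (n.factorial : ℂ) = (2 : ℂ) ^ (-b) := by
  have hx : Tendsto (fun k : ℕ => (1 - 1 / ((k : ℝ) + 1) : ℝ)) atTop (𝓝 1) := by
    simpa using (tendsto_one_div_add_atTop_nhds_zero_nat (𝕜 := ℝ)).const_sub 1
  have hxc : Tendsto (fun k : ℕ => ((1 - 1 / ((k : ℝ) + 1) : ℝ) : ℂ)) atTop (𝓝 1) := by
    rw [← ofReal_one]
    exact (continuous_ofReal.tendsto 1).comp hx
  have hn : ∀ k : ℕ, ‖((1 - 1 / ((k : ℝ) + 1) : ℝ) : ℂ)‖ < 1 := by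
    intro k
    have hk : (0 : ℝ) < 1 / ((k : ℝ) + 1) := by positivity
    have hk' : 1 / ((k : ℝ) + 1) ≤ 1 := by
      rw [div_le_one (by positivity)]
      linarith [(k.cast_nonneg : (0 : ℝ) ≤ k)]
    rw [norm_real, Real.norm_eq_abs, abs_lt]
    constructor <;> linarith
  have h1 : Tendsto (fun k : ℕ => ∑' n : ℕ, (-1) ^ n * poch b n / (n.factorial : ℂ) *
      ((1 - 1 / ((k : ℝ) + 1) : ℝ) : ℂ) ^ n) atTop
      (𝓝 (∑' n : ℕ, (-1) ^ n * poch b n / (n.factorial : ℂ))) := by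
    refine tendsto_tsum_of_dominated_convergence (summable_norm_poch_div_factorial hb)
      (fun n => ?_) (Eventually.of_forall fun k n => ?_)
    · simpa using (hxc.pow n).const_mul ((-1) ^ n * poch b n / (n.factorial : ℂ))
    · rw [mul_div_assoc, norm_mul, norm_mul, norm_pow, norm_neg, norm_one, one_pow, one_mul,
        norm_pow]
      exact mul_le_of_le_one_right (norm_nonneg _) (pow_le_one₀ (norm_nonneg _) (hn k).le)
  refine tendsto_nhds_unique h1 ?_
  simp only [fun k => (hasSum_binomial (b := b) (hn k)).tsum_eq]
  have h2 : ContinuousAt (fun x : ℂ => (1 + x) ^ (-b)) 1 := by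
    refine ContinuousAt.cpow (by fun_prop) continuousAt_const ?_
    norm_num [mem_slitPlane_iff]
  have := h2.tendsto.comp hxc
  rw [one_add_one_eq_two] at this
  exact this

lemma norm_hypTerm (a b c : ℂ) (n : ℕ) : ‖hypTerm a b c n‖ =
    ‖poch a n * (Gamma (c + n))⁻¹‖ * ‖poch b n / (n.factorial : ℂ)‖ := by
  simp only [hypTerm, norm_mul, norm_div, norm_pow, norm_neg, norm_one, one_pow]
  ring

lemma summable_hypTerm {a b c : ℂ} (hac : a.re < c.re) (hb : b.re < -1) :
    Summable (hypTerm a b c) := by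
  obtain ⟨C, hC⟩ := exists_norm_poch_mul_Gamma_inv_le hac
  refine Summable.of_norm_bounded ((summable_norm_poch_div_factorial hb).mul_left C) fun n => ?_
  rw [norm_hypTerm]
  exact mul_le_mul_of_nonneg_right (hC n) (norm_nonneg _)

lemma summable_hypTerm_sub_one {a b c : ℂ} (h : Summable (hypTerm a b c)) :
    Summable (hypTerm a (b - 1) (c + 1)) := by
  refine Summable.of_norm_bounded_eventually_nat (h.norm.mul_left ‖b - 1‖) ?_
  filter_upwards [(tendsto_norm_add_nat_atTop (b - 1)).eventually_ge_atTop 1,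
    (tendsto_norm_add_nat_atTop c).eventually_ge_atTop 1] with n h1 h2
  have h3 : poch (b - 1) n * (b - 1 + n) = (b - 1) * poch b n := by
    rw [← poch_succ, poch_sub_one_succ]
  have h4 : (b - 1 + n) * (c + n) * hypTerm a (b - 1) (c + 1) n =
      (b - 1) * hypTerm a b c n := by
    have h5 : c + ((n + 1 : ℕ) : ℂ) = c + 1 + n := by push_cast; ring
    rw [hypTerm, hypTerm, Gamma_inv_shift c n, h5]
    linear_combination (-1) ^ n * poch a n * (c + n) * (Gamma (c + 1 + n))⁻¹ /
      (n.factorial : ℂ) * h3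
  rw [← norm_mul, ← h4, norm_mul, norm_mul]
  exact le_mul_of_one_le_left (norm_nonneg _) (one_le_mul_of_one_le_of_one_le h1 h2)

/-- The contiguous relation for Kummer's series lowering `b` by one. -/
lemma tsum_hypTerm_kummer_sub_one {a b : ℂ} (h : Summable (hypTerm a b (1 + a - b))) :
    ∑' n, hypTerm a b (1 + a - b) n =
      (1 + a / 2 - b) * ∑' n, hypTerm a (b - 1) (1 + a - b + 1) n := by
  set c := 1 + a - b with hc
  have h' := summable_hypTerm_sub_one h
  rw [← sub_eq_zero, ← tsum_mul_left, ← h.tsum_sub (h'.mul_left _)]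
  refine tsum_eq_zero_of_telescoping (h.sub (h'.mul_left _))
    (g := fun n => 1 / 2 * ((-1) ^ n * poch a (n + 1) * poch b n *
      (Gamma (c + (n + 1 : ℕ)))⁻¹ / (n.factorial : ℂ))) ?_ ?_ ?_
  · have h1 := Gamma_inv_shift c 0
    simp only [Nat.cast_zero, add_zero, zero_add, Nat.cast_one] at h1
    simp only [hypTerm_zero, h1]
    simp only [poch, pow_zero, zero_add, Finset.range_one, Finset.prod_singleton,
      Finset.range_zero, Finset.prod_empty, Nat.factorial_zero, Nat.cast_zero, Nat.cast_one]
    rw [hc]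
    ring
  · intro n
    have e : c + 1 + ((n + 1 : ℕ) : ℂ) = c + ((n + 1 + 1 : ℕ) : ℂ) := by push_cast; ring
    simp only [hypTerm, poch_sub_one_succ, e, Gamma_inv_shift c (n + 1), poch_succ a (n + 1),
      poch_succ b n, Nat.factorial_succ]
    push_cast
    field_simp
    rw [hc]
    ring
  · have h0 := h.tendsto_atTop_zero.norm
    rw [norm_zero] at h0
    refine squeeze_zero_norm' ?_ h0
    filter_upwards [eventually_norm_add_le_two_mul a c, eventually_add_nat_ne_zero c] with n h1 h2
    have h3 : (c + n) * (1 / 2 * ((-1) ^ n * poch a (n + 1) * poch b n *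
      (Gamma (c + (n + 1 : ℕ)))⁻¹ / (n.factorial : ℂ))) = 1 / 2 * (a + n) * hypTerm a b c n := by
      rw [hypTerm, Gamma_inv_shift c n, poch_succ]
      ring
    have h4 := congrArg norm h3
    simp only [norm_mul (c + n), norm_mul _ (hypTerm _ _ _ _), norm_mul (1 / 2) (a + n)] at h4
    have h5 : ‖(1 / 2 : ℂ)‖ = 1 / 2 := by norm_num
    rw [h5] at h4
    have h6 : 0 < ‖c + n‖ := norm_pos_iff.2 h2
    refine le_of_mul_le_mul_left ?_ h6
    rw [h4]
    have := mul_le_mul_of_nonneg_right h1 (norm_nonneg (hypTerm a b c n))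
    linarith

/-- The contiguous relation for Kummer's series raising `a` by two. -/
lemma tsum_hypTerm_kummer_add_two {a b : ℂ} (hb : b.re < -1) :
    ∑' n, hypTerm a b (1 + a - b) n =
      (1 + a) * (2 + a - 2 * b) * ∑' n, hypTerm (a + 2) b (1 + (a + 2) - b) n := by
  have h : Summable (hypTerm a b (1 + a - b)) := summable_hypTerm (by simp; linarith) hb
  have h' : Summable (hypTerm (a + 2) b (1 + (a + 2) - b)) :=
    summable_hypTerm (by simp; linarith) hb
  have hcc : 1 + (a + 2) - b = 1 + a - b + 2 := by ring
  rw [hcc] at h' ⊢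
  set c := 1 + a - b with hc
  rw [← sub_eq_zero, ← tsum_mul_left, ← h.tsum_sub (h'.mul_left _)]
  refine tsum_eq_zero_of_telescoping (h.sub (h'.mul_left _))
    (g := fun n => (b - 1) * ((-1) ^ n * poch (1 + a) n * poch b (n + 1) *
      (Gamma (c + (n + 2 : ℕ)))⁻¹ / (n.factorial : ℂ))) ?_ ?_ ?_
  · have h1 := Gamma_inv_shift c 0
    have h2 := Gamma_inv_shift c 1
    simp only [Nat.cast_zero, add_zero, zero_add] at h1 h2
    simp only [hypTerm_zero, h1, h2]
    simp only [poch, pow_zero, zero_add, Finset.range_one, Finset.prod_singleton,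
      Finset.range_zero, Finset.prod_empty, Nat.factorial_zero, Nat.cast_zero, Nat.cast_one]
    push_cast
    rw [hc]
    ring
  · intro n
    have e : c + 2 + ((n + 1 : ℕ) : ℂ) = c + ((n + 1 + 2 : ℕ) : ℂ) := by push_cast; ring
    have h1 := Gamma_inv_shift c (n + 1)
    have h2 := Gamma_inv_shift c (n + 1 + 1)
    have h3 : (1 + a) * poch (a + 2) (n + 1) = poch (1 + a) n * (1 + a + n) * (2 + a + n) := by
      have : a + 2 = 1 + a + 1 := by ring
      rw [this, ← poch_succ_left, poch_succ, poch_succ]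
      push_cast
      ring
    have h4 : (1 + a) * (2 + a - 2 * b) * hypTerm (a + 2) b (c + 2) (n + 1) =
        (2 + a - 2 * b) * ((-1) ^ (n + 1) * (poch (1 + a) n * (1 + a + n) * (2 + a + n)) *
          poch b (n + 1) * (Gamma (c + ((n + 1 + 2 : ℕ) : ℂ)))⁻¹ / ((n + 1).factorial : ℂ)) := by
      rw [← h3, hypTerm, e]
      ring
    have e2 : n + 1 + 1 + 1 = n + 1 + 2 := rfl
    have e3 : n + 1 + 1 = n + 2 := rfl
    rw [e2] at h2
    have e4 : a + 1 = 1 + a := by ring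
    simp only [h4]
    simp only [hypTerm, h1, h2, ← e3, poch_succ_left a n, e4, poch_succ (1 + a) n,
      poch_succ b (n + 1), Nat.factorial_succ]
    push_cast
    field_simp
    rw [hc]
    ring
  · obtain ⟨C, hC⟩ := exists_norm_poch_mul_Gamma_inv_le (y := 1 + a) (z := c + 2)
      (by simp [hc]; linarith)
    obtain ⟨C', hC'⟩ := exists_norm_poch_div_factorial_le hb
    have hC0 : 0 ≤ C := (norm_nonneg _).trans (hC 0)
    have hlim : Tendsto (fun n : ℕ => ‖b - 1‖ * (C * (2 * (C' * (1 / (n : ℝ)))))) atTop (𝓝 0) := by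
      simpa using ((((tendsto_one_div_atTop_nhds_zero_nat (𝕜 := ℝ)).const_mul C').const_mul
        2).const_mul C).const_mul ‖b - 1‖
    refine squeeze_zero_norm' ?_ hlim
    filter_upwards [eventually_norm_add_le_two_mul b 0, eventually_ge_atTop 1] with n h1 h2
    have hn : (0 : ℝ) < n := by exact_mod_cast h2
    have e : c + ((n + 2 : ℕ) : ℂ) = c + 2 + n := by push_cast; ring
    have h3 : (-1 : ℂ) ^ n * poch (1 + a) n * poch b (n + 1) *
        (Gamma (c + (n + 2 : ℕ)))⁻¹ / (n.factorial : ℂ) = (-1) ^ n *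
        ((poch (1 + a) n * (Gamma (c + 2 + n))⁻¹) * ((b + n) * (poch b n / n.factorial))) := by
      rw [e, poch_succ]
      ring
    rw [h3, norm_mul, norm_mul, norm_pow, norm_neg, norm_one, one_pow, one_mul, norm_mul]
    gcongr
    · exact hC n
    · rw [zero_add, norm_natCast] at h1
      rw [norm_mul, mul_one_div, mul_div_assoc', le_div_iff₀ hn]
      have := mul_le_mul_of_nonneg_right h1
        (mul_nonneg (norm_nonneg (poch b n / (n.factorial : ℂ))) hn.le)
      nlinarith [hC' n]

/-- The value of `₂F₁(a, b; 1 + a - b; -1) / Γ(1 + a - b)` in Kummer's theorem. -/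
def kummerValue (a b : ℂ) : ℂ :=
  (2 : ℂ) ^ (-a) * (Real.sqrt Real.pi : ℂ) * (Gamma ((1 + a) / 2))⁻¹ * (Gamma (1 + a / 2 - b))⁻¹

lemma kummerValue_sub_one (a b : ℂ) :
    kummerValue a b = (1 + a / 2 - b) * kummerValue a (b - 1) := by
  rw [kummerValue, kummerValue, one_div_Gamma_eq_self_mul_one_div_Gamma_add_one (1 + a / 2 - b),
    show 1 + a / 2 - (b - 1) = 1 + a / 2 - b + 1 by ring]
  ring

lemma kummerValue_add_two (a b : ℂ) :
    kummerValue a b = (1 + a) * (2 + a - 2 * b) * kummerValue (a + 2) b := by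
  have h : (2 : ℂ) ^ (-a) = 2 ^ (-(a + 2)) * 4 := by
    rw [show -a = -(a + 2) + (2 : ℕ) by push_cast; ring, cpow_add _ _ two_ne_zero, cpow_natCast]
    norm_num
  rw [kummerValue, kummerValue, one_div_Gamma_eq_self_mul_one_div_Gamma_add_one (1 + a / 2 - b),
    one_div_Gamma_eq_self_mul_one_div_Gamma_add_one ((1 + a) / 2), h,
    show 1 + (a + 2) / 2 - b = 1 + a / 2 - b + 1 by ring,
    show (1 + (a + 2)) / 2 = (1 + a) / 2 + 1 by ring]
  ring

lemma notNonposInt_of_re_pos {z : ℂ} (hz : 0 < z.re) : notNonposInt z := by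
  intro n h
  rw [h] at hz
  simp only [neg_re, natCast_re] at hz
  linarith [(n.cast_nonneg : (0 : ℝ) ≤ n)]

lemma Gamma_mul_GammaSeq {z : ℂ} (hz : notNonposInt z) (n : ℕ) :
    Gamma (z + (n + 1 : ℕ)) * GammaSeq z n = Gamma z * ((n : ℂ) ^ z * n.factorial) := by
  have h : (∏ j ∈ Finset.range (n + 1), (z + j)) ≠ 0 :=
    Finset.prod_ne_zero_iff.2 fun j _ h => hz j (eq_neg_of_add_eq_zero_left h)
  rw [Gamma_add_nat z hz, GammaSeq, poch]
  field_simp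

/-- Ratios of Gamma functions with equal parameter sums tend to one. -/
lemma tendsto_Gamma_ratio {x₁ x₂ y₁ y₂ : ℂ} (hx₁ : 0 < x₁.re) (hx₂ : 0 < x₂.re) (hy₁ : 0 < y₁.re)
    (hy₂ : 0 < y₂.re) (h : x₁ + x₂ = y₁ + y₂) :
    Tendsto (fun n : ℕ => Gamma (y₁ + (n + 1 : ℕ)) * Gamma (y₂ + (n + 1 : ℕ)) /
      (Gamma (x₁ + (n + 1 : ℕ)) * Gamma (x₂ + (n + 1 : ℕ)))) atTop (𝓝 1) := by
  have hg : ∀ {z : ℂ}, 0 < z.re → Gamma z ≠ 0 := fun hz => Gamma_ne_zero_of_re_pos hz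
  have hlim : Tendsto (fun n : ℕ => Gamma y₁ * Gamma y₂ / (Gamma x₁ * Gamma x₂) *
      (GammaSeq x₁ n * GammaSeq x₂ n / (GammaSeq y₁ n * GammaSeq y₂ n))) atTop (𝓝 1) := by
    have := (((GammaSeq_tendsto_Gamma x₁).mul (GammaSeq_tendsto_Gamma x₂)).div
      ((GammaSeq_tendsto_Gamma y₁).mul (GammaSeq_tendsto_Gamma y₂))
      (mul_ne_zero (hg hy₁) (hg hy₂))).const_mul (Gamma y₁ * Gamma y₂ / (Gamma x₁ * Gamma x₂))
    have h1 : Gamma y₁ * Gamma y₂ / (Gamma x₁ * Gamma x₂) *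
        (Gamma x₁ * Gamma x₂ / (Gamma y₁ * Gamma y₂)) = 1 := by
      have := hg hx₁; have := hg hx₂; have := hg hy₁; have := hg hy₂
      field_simp
    rwa [h1] at this
  refine hlim.congr' ?_
  filter_upwards [eventually_ge_atTop 1] with n hn
  have hn0 : (n : ℂ) ≠ 0 := by exact_mod_cast (by omega : n ≠ 0)
  have hf : (n.factorial : ℂ) ≠ 0 := by exact_mod_cast n.factorial_ne_zero
  have hs : ∀ {z : ℂ}, 0 < z.re → GammaSeq z n ≠ 0 ∧ Gamma (z + (n + 1 : ℕ)) ≠ 0 := by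
    intro z hz
    have := Gamma_mul_GammaSeq (notNonposInt_of_re_pos hz) n
    have h2 : Gamma z * ((n : ℂ) ^ z * n.factorial) ≠ 0 :=
      mul_ne_zero (hg hz) (mul_ne_zero (by simp [cpow_eq_zero_iff, hn0]) hf)
    rw [← this] at h2
    exact ⟨right_ne_zero_of_mul h2, left_ne_zero_of_mul h2⟩
  have e : ∀ {z : ℂ}, 0 < z.re → Gamma (z + (n + 1 : ℕ)) =
      Gamma z * ((n : ℂ) ^ z * n.factorial) / GammaSeq z n := fun hz =>
    eq_div_of_mul_eq (hs hz).1 (Gamma_mul_GammaSeq (notNonposInt_of_re_pos hz) n)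
  have hp : (n : ℂ) ^ x₁ * (n : ℂ) ^ x₂ = (n : ℂ) ^ y₁ * (n : ℂ) ^ y₂ := by
    rw [← cpow_add _ _ hn0, ← cpow_add _ _ hn0, h]
  rw [e hx₁, e hx₂, e hy₁, e hy₂]
  have h1 := (hs hx₁).1; have h2 := (hs hx₂).1; have h3 := (hs hy₁).1; have h4 := (hs hy₂).1
  have h5 := hg hx₁; have h6 := hg hx₂
  have h7 : (n : ℂ) ^ x₁ ≠ 0 := by simp [cpow_eq_zero_iff, hn0]
  have h8 : (n : ℂ) ^ x₂ ≠ 0 := by simp [cpow_eq_zero_iff, hn0]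
  field_simp
  linear_combination (Gamma y₁ * Gamma y₂) * hp

lemma tendsto_kummerValue {a b : ℂ} (ha : 0 < a.re) (hb : b.re < -1) :
    Tendsto (fun n : ℕ => Gamma (1 + (a + 2 * (n + 1 : ℕ)) - b) *
      kummerValue (a + 2 * (n + 1 : ℕ)) b) atTop (𝓝 (2 ^ (-b))) := by
  have hlim := (tendsto_Gamma_ratio (x₁ := (1 + a) / 2) (x₂ := 1 + a / 2 - b)
    (y₁ := (1 + a - b) / 2) (y₂ := (1 + a - b) / 2 + 1 / 2) (by simp; linarith)
    (by simp; linarith) (by simp; linarith) (by simp; linarith) (by ring)).const_mul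
    ((2 : ℂ) ^ (-b))
  rw [mul_one] at hlim
  refine hlim.congr fun n => ?_
  have hd := Gamma_mul_Gamma_add_half ((1 + a - b) / 2 + (n + 1 : ℕ))
  have e1 : 2 * ((1 + a - b) / 2 + (n + 1 : ℕ)) = 1 + (a + 2 * (n + 1 : ℕ)) - b := by ring
  have e2 : (1 + a - b) / 2 + 1 / 2 + ((n + 1 : ℕ) : ℂ) =
      (1 + a - b) / 2 + (n + 1 : ℕ) + 1 / 2 := by ring
  have e3 : (1 + (a + 2 * (n + 1 : ℕ))) / 2 = (1 + a) / 2 + ((n + 1 : ℕ) : ℂ) := by ring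
  have e4 : 1 + (a + 2 * (n + 1 : ℕ)) / 2 - b = 1 + a / 2 - b + ((n + 1 : ℕ) : ℂ) := by ring
  have e5 : (2 : ℂ) ^ (-(a + 2 * ((n + 1 : ℕ) : ℂ))) =
      2 ^ (-b) * 2 ^ (1 - (1 + (a + 2 * (n + 1 : ℕ)) - b)) := by
    rw [← cpow_add _ _ two_ne_zero]
    congr 1
    ring
  rw [kummerValue, e2, hd, e1, e3, e4, e5]
  ring

lemma tendsto_tsum_hypTerm {a b : ℂ} (ha : 0 < a.re) (hb : b.re < -1) :
    Tendsto (fun N : ℕ => Gamma (1 + (a + 2 * (N + 1 : ℕ)) - b) *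
      ∑' n, hypTerm (a + 2 * (N + 1 : ℕ)) b (1 + (a + 2 * (N + 1 : ℕ)) - b) n) atTop
      (𝓝 (2 ^ (-b))) := by
  rw [← tsum_binomial_at_one hb]
  have hre : ∀ N : ℕ, 0 < (1 + (a + 2 * (N + 1 : ℕ)) - b).re := by
    intro N
    have : (0 : ℝ) ≤ N := N.cast_nonneg
    simp
    linarith
  have hne : ∀ N k : ℕ, 1 + (a + 2 * (N + 1 : ℕ)) - b + k ≠ 0 := fun N k h =>
    notNonposInt_of_re_pos (hre N) k (eq_neg_of_add_eq_zero_left h)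
  have hterm : ∀ N n : ℕ, Gamma (1 + (a + 2 * (N + 1 : ℕ)) - b) *
      hypTerm (a + 2 * (N + 1 : ℕ)) b (1 + (a + 2 * (N + 1 : ℕ)) - b) n =
      (∏ k ∈ Finset.range n, (a + 2 * (N + 1 : ℕ) + k) / (1 + (a + 2 * (N + 1 : ℕ)) - b + k)) *
      ((-1) ^ n * poch b n / (n.factorial : ℂ)) := by
    intro N n
    have h1 : Gamma (1 + (a + 2 * (N + 1 : ℕ)) - b) ≠ 0 := Gamma_ne_zero_of_re_pos (hre N)
    rw [hypTerm, Gamma_add_nat _ (notNonposInt_of_re_pos (hre N)), Finset.prod_div_distrib]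
    change _ = poch _ n / poch _ n * _
    rw [mul_inv]
    field_simp
  simp only [← tsum_mul_left, hterm]
  refine tendsto_tsum_of_dominated_convergence (summable_norm_poch_div_factorial hb)
    (fun n => ?_) ?_
  · have h1 : Tendsto (fun N : ℕ => ∏ k ∈ Finset.range n,
        (a + 2 * (N + 1 : ℕ) + k) / (1 + (a + 2 * (N + 1 : ℕ)) - b + k)) atTop
        (𝓝 (∏ k ∈ Finset.range n, (1 : ℂ))) := by
      refine tendsto_finsetProd _ fun k _ => ?_
      have h2 : ∀ N : ℕ, (a + 2 * (N + 1 : ℕ) + k) / (1 + (a + 2 * (N + 1 : ℕ)) - b + k) =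
          1 - (1 - b) / 2 * ((3 + a - b + k) / 2 + N)⁻¹ := by
        intro N
        have h3 := hne N k
        have h4 : 1 + (a + 2 * (N + 1 : ℕ)) - b + k = 3 + a - b + k + 2 * N := by
          push_cast
          ring
        have h5 : (3 + a - b + k) / 2 + N = (3 + a - b + k + 2 * N) / 2 := by ring
        rw [h4] at h3
        rw [h4, h5]
        push_cast
        field_simp
        ring
      simp only [h2]
      have h6 : Tendsto (fun N : ℕ => ((3 + a - b + k) / 2 + N : ℂ)⁻¹) atTop (𝓝 0) := by
        rw [tendsto_zero_iff_norm_tendsto_zero]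
        simp only [norm_inv]
        exact (tendsto_norm_add_nat_atTop _).inv_tendsto_atTop
      simpa using (h6.const_mul ((1 - b) / 2)).const_sub 1
    simpa using h1.mul_const ((-1) ^ n * poch b n / (n.factorial : ℂ))
  · have hw : 0 < 2 * (1 - b.re) := by linarith
    have h2 : Tendsto (fun N : ℕ => (a.re * (1 - b.re) + a.im * (-b.im)) + N * (2 * (1 - b.re)))
        atTop atTop :=
      tendsto_atTop_add_const_left _ _ (tendsto_natCast_atTop_atTop.atTop_mul_const hw)
    filter_upwards [h2.eventually_ge_atTop 0] with N hN n
    rw [mul_div_assoc, norm_mul, norm_mul ((-1 : ℂ) ^ n), norm_pow, norm_neg, norm_one, one_pow,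
      one_mul, norm_prod]
    refine mul_le_of_le_one_left (norm_nonneg _) (Finset.prod_le_one (fun _ _ => norm_nonneg _)
      fun k _ => ?_)
    rw [norm_div, div_le_one (norm_pos_iff.2 (hne N k))]
    have h3 := norm_le_norm_add_of_nonneg (u := a + 2 * (N + 1 : ℕ) + k) (w := 1 - b) (by
      have hk : 0 ≤ (k : ℝ) * (1 - b.re) := mul_nonneg k.cast_nonneg (by linarith)
      simp
      nlinarith)
    calc _ ≤ _ := h3
      _ = _ := by ring_nf

lemma tsum_hypTerm_eq_kummerValue_of_re_lt {b : ℂ} (hb : b.re < -1) (a : ℂ) :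
    ∑' n, hypTerm a b (1 + a - b) n = kummerValue a b := by
  have hpos : ∀ a : ℂ, 0 < a.re → ∑' n, hypTerm a b (1 + a - b) n = kummerValue a b := by
    intro a ha
    have hne : ∀ a : ℂ, 0 < a.re → kummerValue a b ≠ 0 := by
      intro a ha
      have hpi : (Real.sqrt Real.pi : ℂ) ≠ 0 := by
        exact_mod_cast (Real.sqrt_pos.2 Real.pi_pos).ne'
      refine mul_ne_zero (mul_ne_zero (mul_ne_zero ?_ hpi) ?_) ?_
      · simp [cpow_eq_zero_iff]
      · exact inv_ne_zero (Gamma_ne_zero_of_re_pos (by simp; linarith))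
      · exact inv_ne_zero (Gamma_ne_zero_of_re_pos (by simp; linarith))
    have hre : ∀ N : ℕ, 0 < (a + 2 * (N : ℂ)).re := by
      intro N
      have : (0 : ℝ) ≤ N := N.cast_nonneg
      simp
      linarith
    have hconst : ∀ N : ℕ, (∑' n, hypTerm a b (1 + a - b) n) / kummerValue a b =
        (∑' n, hypTerm (a + 2 * N) b (1 + (a + 2 * N) - b) n) / kummerValue (a + 2 * N) b := by
      intro N
      induction N with
      | zero => simp
      | succ N ih =>
        have h1 := hne _ (hre N)
        have h2 := hne _ (hre (N + 1))
        have e : a + 2 * ((N + 1 : ℕ) : ℂ) = a + 2 * N + 2 := by push_cast; ring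
        rw [e] at h2 ⊢
        have h3 := kummerValue_add_two (a + 2 * N) b
        rw [h3] at h1
        rw [ih, tsum_hypTerm_kummer_add_two hb, h3, mul_div_mul_left _ _ (left_ne_zero_of_mul h1)]
    have h2b : (2 : ℂ) ^ (-b) ≠ 0 := by simp [cpow_eq_zero_iff]
    have hlim := (tendsto_tsum_hypTerm ha hb).div (tendsto_kummerValue ha hb) h2b
    rw [div_self h2b] at hlim
    have hlim' := hlim.congr (f₂ := fun _ => (∑' n, hypTerm a b (1 + a - b) n) / kummerValue a b)
      (fun N => by
        simp only [Pi.div_apply]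
        rw [mul_div_mul_left _ _ (Gamma_ne_zero_of_re_pos ?_), hconst (N + 1)]
        have := hre (N + 1)
        rw [sub_re, add_re, one_re]
        linarith)
    exact eq_of_div_eq_one (tendsto_nhds_unique tendsto_const_nhds hlim')
  have hind : ∀ (N : ℕ) (a : ℂ), 0 < (a + 2 * N).re →
      ∑' n, hypTerm a b (1 + a - b) n = kummerValue a b := by
    intro N
    induction N with
    | zero => exact fun a ha => hpos a (by simpa using ha)
    | succ N ih =>
      intro a ha
      rw [tsum_hypTerm_kummer_add_two hb, kummerValue_add_two, ih (a + 2)]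
      convert ha using 2
      push_cast
      ring
  obtain ⟨N, hN⟩ := exists_nat_gt (-a.re)
  refine hind N a ?_
  have : (0 : ℝ) ≤ N := N.cast_nonneg
  simp
  linarith

/-- **Kummer's summation theorem**, regularized. -/
theorem tsum_hypTerm_eq_kummerValue {a b : ℂ} (h : Summable (hypTerm a b (1 + a - b))) :
    ∑' n, hypTerm a b (1 + a - b) n = kummerValue a b := by
  have hind : ∀ (N : ℕ) (b : ℂ), b.re < N - 1 → Summable (hypTerm a b (1 + a - b)) →
      ∑' n, hypTerm a b (1 + a - b) n = kummerValue a b := by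
    intro N
    induction N with
    | zero => exact fun b hb _ => tsum_hypTerm_eq_kummerValue_of_re_lt (by simpa using hb) a
    | succ N ih =>
      intro b hb h
      have e : 1 + a - b + 1 = 1 + a - (b - 1) := by ring
      have h' := summable_hypTerm_sub_one h
      rw [tsum_hypTerm_kummer_sub_one h, kummerValue_sub_one]
      rw [e] at h' ⊢
      rw [ih (b - 1) _ h']
      push_cast at hb
      rw [sub_re, one_re]
      linarith
  obtain ⟨N, hN⟩ := exists_nat_gt (b.re + 1)
  exact hind N b (by linarith) h

lemma notNonposInt.ne_zero {z : ℂ} (h : notNonposInt z) : z ≠ 0 := by simpa using h 0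

lemma notNonposInt.add_nat {z : ℂ} (h : notNonposInt z) (k : ℕ) : notNonposInt (z + k) := by
  intro n hn
  refine h (n + k) ?_
  push_cast
  linear_combination hn

lemma hypTerm_lower_succ (a b c : ℂ) (n : ℕ) :
    hypTerm (a - 1) (b - 1) (c - 1) (n + 1) =
      -((a - 1) * (b - 1) / (n + 1)) * hypTerm a b c n := by
  have e : c - 1 + ((n + 1 : ℕ) : ℂ) = c + n := by push_cast; ring
  rw [hypTerm, hypTerm, e, poch_sub_one_succ, poch_sub_one_succ, Nat.factorial_succ]
  push_cast
  field_simp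
  ring

lemma summable_hypTerm_lower {a b c : ℂ} (h : Summable (hypTerm a b c)) :
    Summable (hypTerm (a - 1) (b - 1) (c - 1)) := by
  rw [← summable_nat_add_iff 1]
  refine Summable.of_norm_bounded (h.norm.mul_left ‖(a - 1) * (b - 1)‖) fun n => ?_
  rw [hypTerm_lower_succ, norm_mul, norm_neg, norm_div]
  have h1 : ‖(n : ℂ) + 1‖ = n + 1 := by
    rw [← Nat.cast_add_one, norm_natCast]
    push_cast
    rfl
  rw [h1]
  gcongr
  refine div_le_self (norm_nonneg _) ?_
  linarith [(n.cast_nonneg : (0 : ℝ) ≤ n)]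

lemma hypTerm_contiguous_zero (a b c : ℂ) :
    (c - b) * hypTerm a (b - 1) c 0 =
      hypTerm (a - 1) (b - 1) (c - 1) 0 - (b - 1) * hypTerm a b c 0 := by
  simp only [hypTerm_zero]
  rw [one_div_Gamma_eq_self_mul_one_div_Gamma_add_one (c - 1), sub_add_cancel]
  ring

lemma hypTerm_contiguous_succ (a b c : ℂ) (n : ℕ) :
    (c - b) * hypTerm a (b - 1) c (n + 1) =
      hypTerm (a - 1) (b - 1) (c - 1) (n + 1) -
        (b - 1) * (hypTerm a b c (n + 1) + hypTerm a b c n) := by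
  rw [hypTerm_lower_succ]
  simp only [hypTerm, Gamma_inv_shift c n, poch_sub_one_succ]
  simp only [poch_succ, Nat.factorial_succ]
  push_cast
  field_simp
  ring

lemma summable_hypTerm_lower_middle {a b c : ℂ} (hcb : c - b ≠ 0) (h : Summable (hypTerm a b c)) :
    Summable (hypTerm a (b - 1) c) := by
  rw [← summable_mul_left_iff hcb, ← summable_nat_add_iff 1]
  simp only [hypTerm_contiguous_succ]
  exact ((summable_nat_add_iff 1).2 (summable_hypTerm_lower h)).sub
    ((((summable_nat_add_iff 1).2 h).add h).mul_left _)

lemma tsum_hypTerm_contiguous {a b c : ℂ} (hcb : c - b ≠ 0) (h : Summable (hypTerm a b c)) :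
    2 * (b - 1) * ∑' n, hypTerm a b c n =
      ∑' n, hypTerm (a - 1) (b - 1) (c - 1) n - (c - b) * ∑' n, hypTerm a (b - 1) c n := by
  have hs := (summable_nat_add_iff 1).2 h
  have hl := summable_hypTerm_lower h
  have hm := summable_hypTerm_lower_middle hcb h
  have h1 : (c - b) * ∑' n, hypTerm a (b - 1) c (n + 1) =
      ∑' n, hypTerm (a - 1) (b - 1) (c - 1) (n + 1) -
        (b - 1) * (∑' n, hypTerm a b c (n + 1) + ∑' n, hypTerm a b c n) := by
    rw [← tsum_mul_left, ← hs.tsum_add h, ← tsum_mul_left,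
      ← ((summable_nat_add_iff 1).2 hl).tsum_sub ((hs.add h).mul_left _)]
    exact tsum_congr fun n => hypTerm_contiguous_succ a b c n
  rw [hl.tsum_eq_zero_add, hm.tsum_eq_zero_add]
  linear_combination h1 + hypTerm_contiguous_zero a b c + (b - 1) * h.tsum_eq_zero_add

/-- The alternating sum of Gamma quotients in the generalized Kummer theorem. -/
def gammaSum (i : ℕ) (s b : ℂ) : ℂ :=
  ∑ r ∈ Finset.range (i + 1), (-1 : ℂ) ^ r * (i.choose r : ℂ) * Gamma ((s + r) / 2) /
    Gamma ((s + r) / 2 + b - i)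

lemma gammaSum_succ (i : ℕ) (s b : ℂ) :
    gammaSum (i + 1) s b = gammaSum i s (b - 1) - gammaSum i (s + 1) (b - 1) := by
  have h := Finset.sum_choose_succ_mul (R := ℂ) (fun r _ => (-1 : ℂ) ^ r * Gamma ((s + r) / 2) /
    Gamma ((s + r) / 2 + b - (i + 1 : ℕ))) i
  have h0 : gammaSum (i + 1) s b = ∑ r ∈ Finset.range (i + 2), ((i + 1).choose r : ℂ) *
      ((-1 : ℂ) ^ r * Gamma ((s + r) / 2) / Gamma ((s + r) / 2 + b - (i + 1 : ℕ))) := by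
    refine Finset.sum_congr rfl fun r _ => ?_
    ring
  rw [h0, h, gammaSum, gammaSum, sub_eq_add_neg, ← Finset.sum_neg_distrib]
  congr 1 <;> refine Finset.sum_congr rfl fun r _ => ?_
  · rw [show (s + r) / 2 + (b - 1) - i = (s + r) / 2 + b - (i + 1 : ℕ) by push_cast; ring]
    ring
  · rw [show (s + 1 + r) / 2 + (b - 1) - i = (s + (r + 1 : ℕ)) / 2 + b - (i + 1 : ℕ) by
      push_cast; ring, show (s + 1 + r) / 2 = (s + (r + 1 : ℕ)) / 2 by push_cast; ring]
    ring

/-- Generalized Kummer summation, regularized. -/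
theorem tsum_hypTerm_eq_gammaSum (i : ℕ) : ∀ {s b : ℂ}, notNonposInt s → notNonposInt (b - i) →
    Summable (hypTerm (s + 2 * b - 1 - i) b (b + s)) →
    ∑' n, hypTerm (s + 2 * b - 1 - i) b (b + s) n =
      (2 : ℂ) ^ (i - 2 * b) * Gamma (b - i) / (Gamma s * Gamma b) * gammaSum i s b := by
  induction i with
  | zero =>
    intro s b hs hb h
    have e : b + s = 1 + (s + 2 * b - 1 - (0 : ℕ)) - b := by push_cast; ring
    rw [e] at h ⊢
    rw [tsum_hypTerm_eq_kummerValue h, kummerValue]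
    simp only [Nat.cast_zero, sub_zero, zero_sub, gammaSum, zero_add, Finset.range_one,
      Finset.sum_singleton, pow_zero, Nat.choose_self, Nat.cast_one, one_mul, add_zero] at hb ⊢
    have hgb : Gamma b ≠ 0 := Gamma_ne_zero hb
    have hgs : Gamma s ≠ 0 := Gamma_ne_zero hs
    have hd := Gamma_mul_Gamma_add_half (s / 2)
    have hs2 : Gamma (s / 2 + 1 / 2) ≠ 0 := by
      refine Gamma_ne_zero fun n h => hs (2 * n + 1) ?_
      push_cast
      linear_combination 2 * h
    rw [show 1 + (s + 2 * b - 1) / 2 - b = s / 2 + 1 / 2 by ring,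
      show (1 + (s + 2 * b - 1)) / 2 = s / 2 + b by ring]
    have hp : (2 : ℂ) ^ (-(s + 2 * b - 1)) = 2 ^ (-(2 * b)) * 2 ^ (1 - s) := by
      rw [← cpow_add _ _ two_ne_zero]
      congr 1
      ring
    rw [show 2 * (s / 2) = s by ring] at hd
    have hq := eq_div_of_mul_eq hs2 hd
    rw [hp, hq]
    generalize Gamma (s / 2 + b) = X
    generalize Gamma (s / 2 + 1 / 2) = Y at hs2 ⊢
    field_simp
  | succ i ih =>
    intro s b hs hb h
    have hs0 := hs.ne_zero
    have hb1 : b - 1 ≠ 0 := by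
      have := (hb.add_nat i).ne_zero
      rwa [show b - ((i + 1 : ℕ) : ℂ) + i = b - 1 by push_cast; ring] at this
    have hb' : notNonposInt (b - 1 - i) := by
      rwa [show b - 1 - (i : ℂ) = b - ((i + 1 : ℕ) : ℂ) by push_cast; ring]
    have hcb : b + s - b ≠ 0 := by simpa using hs0
    have h1 := summable_hypTerm_lower h
    have h2 := summable_hypTerm_lower_middle hcb h
    have h3 := tsum_hypTerm_contiguous hcb h
    rw [show s + 2 * b - 1 - ((i + 1 : ℕ) : ℂ) - 1 = s + 2 * (b - 1) - 1 - i by push_cast; ring,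
      show b + s - 1 = b - 1 + s by ring] at h1 h3
    rw [show s + 2 * b - 1 - ((i + 1 : ℕ) : ℂ) = s + 1 + 2 * (b - 1) - 1 - i by push_cast; ring,
      show b + s = b - 1 + (s + 1) by ring] at h2 h3 ⊢
    have hs1 : notNonposInt (s + 1) := by exact_mod_cast hs.add_nat 1
    rw [ih hs hb' h1, ih hs1 hb' h2, Gamma_add_one s hs0,
      show b - 1 + (s + 1) - b = s by ring] at h3
    have hgb : Gamma b = (b - 1) * Gamma (b - 1) := by
      rw [← Gamma_add_one _ hb1, sub_add_cancel]
    have hgs : Gamma s ≠ 0 := Gamma_ne_zero hs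
    have hgb1 : Gamma (b - 1) ≠ 0 := by
      refine Gamma_ne_zero fun n h => hb' (n + i) ?_
      rw [h]
      push_cast
      ring
    have hp : (2 : ℂ) ^ (i - 2 * (b - 1)) = 2 * 2 ^ (((i + 1 : ℕ) : ℂ) - 2 * b) := by
      rw [show (i : ℂ) - 2 * (b - 1) = 1 + (((i + 1 : ℕ) : ℂ) - 2 * b) by push_cast; ring,
        cpow_add _ _ two_ne_zero, cpow_one]
    rw [hp] at h3
    refine mul_left_cancel₀ (mul_ne_zero two_ne_zero hb1) ?_
    rw [h3, hgb, gammaSum_succ, show b - ((i + 1 : ℕ) : ℂ) = b - 1 - i by push_cast; ring]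
    field_simp

lemma sum_choose_poch (N : ℕ) : ∀ {w x c d : ℂ}, c = d + x + 1 → (∀ n, poch c n ≠ 0) →
    d * ∑ n ∈ Finset.range (N + 1), (N.choose n : ℂ) *
      ((-1) ^ n * (w + n) * poch x n / poch c n) =
      poch d N / poch c N * (w * (d + N) - N * x) := by
  induction N with
  | zero =>
    intro w x c d _ _
    simp [poch_zero]
    ring
  | succ N ih =>
    intro w x c d hc hp
    have hc0 : c ≠ 0 := by simpa [poch] using hp 1
    have hp' : ∀ n, poch (c + 1) n ≠ 0 := fun n => by
      have := hp (n + 1)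
      rw [poch_succ_left] at this
      exact right_ne_zero_of_mul this
    have hcN : c + N ≠ 0 := by
      have := hp (N + 1)
      rw [poch_succ] at this
      exact right_ne_zero_of_mul this
    have h := Finset.sum_choose_succ_mul (R := ℂ)
      (fun n _ => (-1) ^ n * (w + n) * poch x n / poch c n) N
    have h1 : ∑ n ∈ Finset.range (N + 1), (N.choose n : ℂ) *
        ((-1) ^ (n + 1) * (w + (n + 1 : ℕ)) * poch x (n + 1) / poch c (n + 1)) = -(x / c) *
        ∑ n ∈ Finset.range (N + 1), (N.choose n : ℂ) *
        ((-1) ^ n * (w + 1 + n) * poch (x + 1) n / poch (c + 1) n) := by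
      rw [Finset.mul_sum]
      refine Finset.sum_congr rfl fun n _ => ?_
      have := hp' n
      rw [poch_succ_left, poch_succ_left]
      push_cast
      field_simp
      ring
    have h2 := ih (w := w) hc hp
    have h3 := ih (w := w + 1) (x := x + 1) (c := c + 1) (d := d) (by rw [hc]; ring) hp'
    have h4 : poch (c + 1) N = poch c N * (c + N) / c := by
      rw [eq_div_iff hc0, ← poch_succ, poch_succ_left]
      ring
    have hpN := hp N
    simp only [h1] at h
    rw [h]
    rw [show ∀ A B : ℂ, d * (A + -(x / c) * B) = d * A + -(x / c) * (d * B) from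
      fun A B => by ring, h2, h3, h4, poch_succ, poch_succ]
    push_cast
    field_simp
    rw [hc]
    ring

lemma sum_antidiagonal_kdfTerm_s18 {α β γ : ℂ} (hβ : ∀ n, poch β n ≠ 0)
    (hd1 : ∀ n, poch (γ / 2) n ≠ 0) (hd2 : ∀ n, poch (1 + (γ + β) / 2) n ≠ 0)
    (hc : notNonposInt (1 + (γ + β) / 2)) (N : ℕ) :
    ∑ p ∈ Finset.HasAntidiagonal.antidiagonal N,
      kdfTerm α γ (1 + γ / 2) ((γ - β) / 2) β (γ / 2) (1 + (γ + β) / 2) (-1) 1 p =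
      Gamma (1 + (γ + β) / 2) * hypTerm α (γ + 1) (1 + (γ + β) / 2) N := by
  have hγ : γ ≠ 0 := by
    intro h
    apply hd1 1
    simp [poch, h]
  have hβ0 : β ≠ 0 := by simpa [poch] using hβ 1
  have hNf : (N.factorial : ℂ) ≠ 0 := by exact_mod_cast N.factorial_ne_zero
  have hterm : ∀ k ∈ Finset.range (N + 1),
      kdfTerm α γ (1 + γ / 2) ((γ - β) / 2) β (γ / 2) (1 + (γ + β) / 2) (-1) 1 (N - k, k) =
      poch α N * poch γ N / poch β N / N.factorial * (-1) ^ N / (γ / 2) * ((N.choose k : ℂ) *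
        ((-1) ^ k * (γ / 2 + k) * poch ((γ - β) / 2) k / poch (1 + (γ + β) / 2) k)) := by
    intro k hk
    have hkN : k ≤ N := Nat.lt_succ_iff.1 (Finset.mem_range.1 hk)
    have hch : (N.choose k : ℂ) = N.factorial / (k.factorial * (N - k).factorial) := by
      rw [Nat.cast_choose ℂ hkN]
    have hs : (-1 : ℂ) ^ (N - k) = (-1) ^ N * (-1) ^ k := by
      obtain ⟨m, rfl⟩ := Nat.exists_eq_add_of_le hkN
      rw [Nat.add_sub_cancel_left, pow_add]
      have : (-1 : ℂ) ^ k * (-1) ^ k = 1 := by rw [← mul_pow]; simp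
      linear_combination -(-1 : ℂ) ^ m * this
    have hw : poch (1 + γ / 2) k = poch (γ / 2) k * (γ / 2 + k) / (γ / 2) := by
      rw [eq_div_iff (by simpa using hγ), ← poch_succ, poch_succ_left, add_comm (γ / 2) 1]
      ring
    have h1 := hβ N; have h2 := hd1 k; have h3 := hd2 k
    have h4 : (k.factorial : ℂ) ≠ 0 := by exact_mod_cast k.factorial_ne_zero
    have h5 : ((N - k).factorial : ℂ) ≠ 0 := by exact_mod_cast (N - k).factorial_ne_zero
    simp only [kdfTerm, Nat.sub_add_cancel hkN, one_pow]
    rw [hch, hs, hw]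
    field_simp
  rw [← Finset.Nat.sum_antidiagonal_swap, Finset.Nat.sum_antidiagonal_eq_sum_range_succ_mk]
  simp only [Prod.swap_prod_mk]
  rw [Finset.sum_congr rfl hterm, ← Finset.mul_sum]
  have hsum := sum_choose_poch N (w := γ / 2) (x := (γ - β) / 2) (c := 1 + (γ + β) / 2) (d := β)
    (by ring) hd2
  rw [mul_comm β, ← eq_div_iff hβ0] at hsum
  have h1 := hβ N; have h3 := hd2 N
  have hG : Gamma (1 + (γ + β) / 2) ≠ 0 := Gamma_ne_zero hc
  have hg : poch γ N * (γ + N) = γ * poch (γ + 1) N := by rw [← poch_succ, poch_succ_left]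
  rw [hsum, hypTerm, Gamma_add_nat _ hc, mul_inv]
  generalize poch (1 + (γ + β) / 2) N = P at h3 ⊢
  generalize Gamma (1 + (γ + β) / 2) = G at hG ⊢
  field_simp
  linear_combination poch α N * β * hg

theorem stmt_18 (i : ℕ) (β γ α : ℂ)
    (hα : α = β / 2 + 3 * γ / 2 + 1 - (i : ℂ))
    (hβ : ∀ m n : ℕ, poch β (m + n) ≠ 0)
    (hd1 : ∀ n : ℕ, poch (γ / 2) n ≠ 0)
    (hd2 : ∀ n : ℕ, poch (1 + (γ + β) / 2) n ≠ 0)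
    (hΓ1 : notNonposInt (1 + (β + γ) / 2))
    (hΓ2 : notNonposInt (γ - (i : ℂ) + 1))
    (hΓ3 : notNonposInt ((β - γ) / 2))
    (hΓ4 : notNonposInt (γ + 1))
    (hΓs : ∀ r : ℕ, r ≤ i →
      notNonposInt ((β - γ) / 4 + (r : ℂ) / 2) ∧ notNonposInt ((β + 3 * γ) / 4 + 1 - (i : ℂ) + (r : ℂ) / 2))
    (hsum : Summable fun p : ℕ × ℕ => ‖kdfTerm α γ (1 + γ / 2) ((γ - β) / 2) β (γ / 2) (1 + (γ + β) / 2) (-1) 1 p‖) :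
    (∑' p : ℕ × ℕ, kdfTerm α γ (1 + γ / 2) ((γ - β) / 2) β (γ / 2) (1 + (γ + β) / 2) (-1) 1 p) =
      (2 : ℂ) ^ ((β - γ) / 2 - α - 1) * Gamma (1 + (β + γ) / 2) * Gamma (γ - (i : ℂ) + 1) /
        (Gamma ((β - γ) / 2) * Gamma (γ + 1)) *
      ∑ r ∈ Finset.range (i + 1), (-1 : ℂ) ^ r * (i.choose r : ℂ) *
        Gamma ((β - γ) / 4 + (r : ℂ) / 2) /
        Gamma ((β + 3 * γ) / 4 + 1 - (i : ℂ) + (r : ℂ) / 2) := by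
  have hc : 1 + (β + γ) / 2 = 1 + (γ + β) / 2 := by ring
  have hcs : 1 + (γ + β) / 2 = γ + 1 + (β - γ) / 2 := by ring
  have ha : α = (β - γ) / 2 + 2 * (γ + 1) - 1 - i := by rw [hα]; ring
  rw [hc] at hΓ1 ⊢
  have hG := Gamma_ne_zero hΓ1
  have hanti := sum_antidiagonal_kdfTerm_s18 (α := α) (fun n => by simpa using hβ 0 n) hd1 hd2 hΓ1
  have hs : Summable fun x : Σ n : ℕ, Finset.HasAntidiagonal.antidiagonal n =>
      kdfTerm α γ (1 + γ / 2) ((γ - β) / 2) β (γ / 2) (1 + (γ + β) / 2) (-1) 1 x.2 :=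
    (Finset.HasAntidiagonal.sigmaAntidiagonalEquivProd.summable_iff).2 hsum.of_norm
  have hsum' : Summable (hypTerm α (γ + 1) (1 + (γ + β) / 2)) := by
    rw [← summable_mul_left_iff hG]
    simp only [← hanti]
    conv => congr; ext; rw [← Finset.sum_finset_coe, ← tsum_fintype (L := .unconditional _)]
    exact hs.sigma' fun n => (hasSum_fintype _).summable
  have htsum : ∑' p, kdfTerm α γ (1 + γ / 2) ((γ - β) / 2) β (γ / 2) (1 + (γ + β) / 2) (-1) 1 p =
      Gamma (1 + (γ + β) / 2) * ∑' n, hypTerm α (γ + 1) (1 + (γ + β) / 2) n := by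
    rw [← tsum_mul_left, ← Finset.HasAntidiagonal.sigmaAntidiagonalEquivProd.tsum_eq]
    refine (hs.tsum_sigma' fun n => (hasSum_fintype _).summable).trans (tsum_congr fun n => ?_)
    rw [← hanti, tsum_fintype]
    exact Finset.sum_finset_coe _ _
  have hexp : (i : ℂ) - 2 * (γ + 1) = (β - γ) / 2 - α - 1 := by rw [ha]; ring
  rw [htsum]
  have hb : notNonposInt (γ + 1 - i) := by rwa [show γ + 1 - (i : ℂ) = γ - i + 1 by ring]
  have hmain := tsum_hypTerm_eq_gammaSum i hΓ3 hb (by rwa [← ha, ← hcs])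
  rw [← ha, ← hcs, hexp] at hmain
  rw [hmain, show γ + 1 - (i : ℂ) = γ - i + 1 by ring]
  have hsumeq : gammaSum i ((β - γ) / 2) (γ + 1) =
      ∑ r ∈ Finset.range (i + 1), (-1 : ℂ) ^ r * (i.choose r : ℂ) *
        Gamma ((β - γ) / 4 + (r : ℂ) / 2) /
        Gamma ((β + 3 * γ) / 4 + 1 - (i : ℂ) + (r : ℂ) / 2) := by
    refine Finset.sum_congr rfl fun r _ => ?_
    rw [show ((β - γ) / 2 + r) / 2 + (γ + 1) - i = (β + 3 * γ) / 4 + 1 - i + r / 2 by ring,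
      show ((β - γ) / 2 + r) / 2 = (β - γ) / 4 + r / 2 by ring]
  rw [hsumeq]
  ring
end
end
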